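/- arXiv:1505.04917 — 4 statements merged into one kernel-verified Lean document; each statement's English description precedes it below -/
import Mathlib

section
/- Let D ⊆ ℂⁿ be a bounded domain and A ⊆ ∂D. Then ω(z, A, D) = sup{ω(z, V, D) : V relatively open in ∂D, A ⊆ V} for every z ∈ D, and there exists a non-increasing sequence (V_j) of relatively open neighborhoods of A in ∂D such that lim_{j→∞} ω(z, V_j, D) = ω(z, A, D) for Lebesgue-almost every z ∈ D. -/
open Complex Metric MeasureTheory Filter Topology Set

noncomputable section

/-- The average of the truncation `max u (-m)` of an `EReal`-valued function `u` over the
circle of center `c` and radius `r`. -/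
noncomputable def truncCircleAvg (u : ℂ → EReal) (c : ℂ) (r : ℝ) (m : ℕ) : ℝ :=
  (2 * Real.pi)⁻¹ *
    ∫ θ in (0:ℝ)..(2 * Real.pi),
      (max (u (c + (r : ℂ) * Complex.exp (θ * Complex.I))) ((-(m : ℝ) : ℝ) : EReal)).toReal

/-- A `[-∞,∞]`-valued function is subharmonic on `U ⊆ ℂ` if it is upper semicontinuous
on `U` and satisfies the sub-mean value inequality on every closed disc contained in `U`
(expressed via averages of truncations from below). -/
def SubharmonicOn (u : ℂ → EReal) (U : Set ℂ) : Prop :=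
  UpperSemicontinuousOn u U ∧
    ∀ c r, 0 < r → Metric.closedBall c r ⊆ U →
      ∀ m : ℕ, u c ≤ ((truncCircleAvg u c r m : ℝ) : EReal)

variable {E : Type*} [NormedAddCommGroup E] [NormedSpace ℂ E]

/-- Plurisubharmonic on `D`: upper semicontinuous on `D`, with values in `[-∞, ∞)`,
whose restriction to every complex line is subharmonic.  (The constant `-∞` is allowed
here; the paper's class `PSH(D)` additionally requires `u ≢ -∞`, see `MemPSH`.) -/
def PshOn (u : E → EReal) (D : Set E) : Prop :=
  UpperSemicontinuousOn u D ∧ (∀ z ∈ D, u z ≠ ⊤) ∧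
    ∀ a b : E, SubharmonicOn (fun ζ : ℂ => u (a + ζ • b)) {ζ : ℂ | a + ζ • b ∈ D}

/-- Membership in the paper's class `PSH(D)`: plurisubharmonic and not identically `-∞`. -/
def MemPSH (u : E → EReal) (D : Set E) : Prop :=
  PshOn u D ∧ ∃ z ∈ D, u z ≠ ⊥

/-- The upper semicontinuous regularization `u*` of `u` on `cl(D)`:
`u*(x) = limsup_{z → x, z ∈ D} u(z)`. -/
noncomputable def uscReg (u : E → EReal) (D : Set E) (x : E) : EReal :=
  Filter.limsup u (nhdsWithin x D)

/-- The boundary relative extremal function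
`ω(z, A, D) = sup { u(z) : u ∈ PSH(D), u ≤ 0 on D, u* ≤ -1 on A }`. -/
noncomputable def bndExt (z : E) (A D : Set E) : EReal :=
  sSup {w : EReal | ∃ u : E → EReal, MemPSH u D ∧ (∀ y ∈ D, u y ≤ 0) ∧
    (∀ x ∈ A, uscReg u D x ≤ -1) ∧ w = u z}

/-- The upper semicontinuous regularization `ω*(·, A, D)` on `cl(D)`. -/
noncomputable def bndExtStar (x : E) (A D : Set E) : EReal :=
  Filter.limsup (fun z => bndExt z A D) (nhdsWithin x D)

/-- A bounded domain: a nonempty connected bounded open set. -/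
def IsBddDomain (D : Set E) : Prop :=
  IsOpen D ∧ IsConnected D ∧ Bornology.IsBounded D

/-- `A ⊆ ∂D` is b-pluripolar if there is `u ∈ PSH(D)`, `u ≤ 0`, `u ≢ -∞`,
with `u* = -∞` on `A`. -/
def BPluripolar (A D : Set E) : Prop :=
  ∃ u : E → EReal, PshOn u D ∧ (∀ z ∈ D, u z ≤ 0) ∧ (∃ z ∈ D, u z ≠ ⊥) ∧
    ∀ x ∈ A, uscReg u D x = ⊥

/-- The b-pluripolar hull `Â` of `A ⊆ ∂D`: all points `z ∈ cl(D)` such that `u*(z) = -∞`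
for every negative `u ∈ PSH(D)`, `u ≢ -∞`, with `u* = -∞` on `A`. -/
def bHull (A D : Set E) : Set E :=
  {z ∈ closure D | ∀ u : E → EReal, PshOn u D → (∀ y ∈ D, u y < 0) →
    (∃ y ∈ D, u y ≠ ⊥) → (∀ x ∈ A, uscReg u D x = ⊥) → uscReg u D z = ⊥}

/-- Weak regularity: for every relatively open `U ⊆ ∂D` one has `ω*(·, U, D) ≤ -1` on `U`. -/
def WeaklyRegular (D : Set E) : Prop :=
  ∀ U W : Set E, IsOpen W → U = W ∩ frontier D → ∀ x ∈ U, bndExtStar x U D ≤ -1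

/-- B-regularity (Sibony): every continuous `f : ∂D → ℝ` extends to a function
plurisubharmonic on `D` and continuous on `cl(D)` with boundary values `f`. -/
def BRegular (D : Set E) : Prop :=
  ∀ f : E → ℝ, ContinuousOn f (frontier D) →
    ∃ F : E → ℝ, ContinuousOn F (closure D) ∧
      PshOn (fun z => ((F z : ℝ) : EReal)) D ∧ ∀ x ∈ frontier D, F x = f x

/-- The extremal function `ω₁(z, K, D)`, defined with continuous-up-to-the-boundary
plurisubharmonic competitors. -/
noncomputable def bndExtCont (z : E) (K D : Set E) : EReal :=
  sSup {w : EReal | ∃ F : E → ℝ, ContinuousOn F (closure D) ∧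
    PshOn (fun y => ((F y : ℝ) : EReal)) D ∧ (∀ y ∈ closure D, F y ≤ 0) ∧
    (∀ x ∈ K, F x ≤ -1) ∧ w = ((F z : ℝ) : EReal)}

end

open Complex Metric MeasureTheory Filter Topology Set

section aux

set_option linter.unusedSectionVars false

lemma trunc_coe (x : EReal) (hx : x ≤ 0) (m : ℕ) :
    (((max x ((-(m : ℝ) : ℝ) : EReal)).toReal : ℝ) : EReal) = max x ((-(m : ℝ) : ℝ) : EReal) := by
  apply EReal.coe_toReal
  · have : max x ((-(m : ℝ) : ℝ) : EReal) < ⊤ :=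
      max_lt (lt_of_le_of_lt hx EReal.zero_lt_top) (EReal.coe_lt_top _)
    exact this.ne
  · have : ⊥ < max x ((-(m : ℝ) : ℝ) : EReal) :=
      lt_of_lt_of_le (EReal.bot_lt_coe _) (le_max_right _ _)
    exact this.ne'

lemma trunc_le_zero (x : EReal) (hx : x ≤ 0) (m : ℕ) :
    (max x ((-(m : ℝ) : ℝ) : EReal)).toReal ≤ 0 := by
  rw [← EReal.coe_le_coe_iff, trunc_coe x hx]
  refine max_le hx ?_
  simp

lemma le_trunc (x : EReal) (hx : x ≤ 0) (m : ℕ) :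
    -(m : ℝ) ≤ (max x ((-(m : ℝ) : ℝ) : EReal)).toReal := by
  rw [← EReal.coe_le_coe_iff, trunc_coe x hx]
  exact le_max_right _ _

lemma circle_mem (c : ℂ) (r θ : ℝ) (hr : 0 < r) :
    c + (r : ℂ) * Complex.exp (θ * Complex.I) ∈ closedBall c r := by
  simp [Complex.norm_exp_ofReal_mul_I, abs_of_pos hr]

lemma circle_meas {f : ℂ → EReal} {U : Set ℂ} (hf : UpperSemicontinuousOn f U) (c : ℂ) (r : ℝ)
    (hr : 0 < r) (h : closedBall c r ⊆ U) :
    Measurable fun θ : ℝ => f (c + (r : ℂ) * Complex.exp (θ * Complex.I)) := by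
  apply UpperSemicontinuous.measurable
  have hg : Continuous fun θ : ℝ => c + (r : ℂ) * Complex.exp (θ * Complex.I) := by fun_prop
  have := UpperSemicontinuousOn.comp (t := univ) hf hg.continuousOn
    (fun θ _ => h (circle_mem c r θ hr))
  exact upperSemicontinuousOn_univ_iff.1 this

lemma circle_int {f : ℂ → EReal} {U : Set ℂ} (hf : UpperSemicontinuousOn f U) (c : ℂ) (r : ℝ)
    (hr : 0 < r) (h : closedBall c r ⊆ U) (h0 : ∀ x ∈ U, f x ≤ 0) (m : ℕ) :
    IntervalIntegrable (fun θ : ℝ =>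
      (max (f (c + (r : ℂ) * Complex.exp (θ * Complex.I))) ((-(m : ℝ) : ℝ) : EReal)).toReal)
      volume 0 (2 * Real.pi) := by
  rw [intervalIntegrable_iff]
  apply Measure.integrableOn_of_bounded (M := m)
  · have : (2 : ENNReal) * ENNReal.ofReal |Real.pi| ≠ ⊤ :=
      ENNReal.mul_ne_top ENNReal.ofNat_ne_top ENNReal.ofReal_ne_top
    simpa using this
  · exact (((circle_meas hf c r hr h).max measurable_const).ereal_toReal).aestronglyMeasurable
  · refine Eventually.of_forall fun θ => ?_
    have := h0 _ (h (circle_mem c r θ hr))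
    rw [Real.norm_eq_abs, abs_le]
    exact ⟨le_trunc _ this _, (trunc_le_zero _ this _).trans (by positivity)⟩

lemma ereal_scale_mono (c : ℝ) (hc : 1 ≤ c) : Monotone fun y : EReal => (c : EReal) * y :=
  fun _ _ h => mul_le_mul_of_nonneg_left h (by exact_mod_cast (zero_le_one.trans hc))

lemma ereal_scale_cont (c : ℝ) (hc : 1 ≤ c) : Continuous fun y : EReal => (c : EReal) * y := by
  have h0 : (c : EReal) ≠ 0 := by
    have : c ≠ 0 := by linarith
    exact_mod_cast this
  rw [continuous_iff_continuousAt]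
  intro y
  exact EReal.Tendsto.const_mul tendsto_id (Or.inl (EReal.coe_ne_bot _)) (Or.inl (EReal.coe_ne_top _))

lemma ereal_scale_nonpos (c : ℝ) (hc : 1 ≤ c) {y : EReal} (hy : y ≤ 0) : (c : EReal) * y ≤ 0 := by
  have := ereal_scale_mono c hc hy
  simpa using this

lemma trunc_scale (c : ℝ) (hc : 1 ≤ c) (y : EReal) (hy : y ≤ 0) (m : ℕ) :
    c * (max y ((-(m : ℝ) : ℝ) : EReal)).toReal ≤
      (max ((c : EReal) * y) ((-(m : ℝ) : ℝ) : EReal)).toReal := by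
  rw [← EReal.coe_le_coe_iff, EReal.coe_mul, trunc_coe y hy,
    trunc_coe _ (ereal_scale_nonpos c hc hy)]
  rw [(ereal_scale_mono c hc).map_max]
  refine max_le_max le_rfl ?_
  rw [← EReal.coe_mul, EReal.coe_le_coe_iff]
  have : (0:ℝ) ≤ m := by positivity
  nlinarith

lemma subharmonic_scale {f : ℂ → EReal} {U : Set ℂ} (hf : SubharmonicOn f U)
    (h0 : ∀ x ∈ U, f x ≤ 0) (c : ℝ) (hc : 1 ≤ c) :
    SubharmonicOn (fun x => (c : EReal) * f x) U := by
  have husc : UpperSemicontinuousOn (fun x => (c : EReal) * f x) U :=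
    (ereal_scale_cont c hc).comp_upperSemicontinuousOn hf.1 (ereal_scale_mono c hc)
  refine ⟨husc, fun x r hr h m => ?_⟩
  have h1 := ereal_scale_mono c hc (hf.2 x r hr h m)
  refine h1.trans ?_
  dsimp only
  rw [← EReal.coe_mul, EReal.coe_le_coe_iff]
  unfold truncCircleAvg
  rw [mul_left_comm, ← intervalIntegral.integral_const_mul]
  refine mul_le_mul_of_nonneg_left ?_ (by positivity)
  refine intervalIntegral.integral_mono_on (by positivity)
    ((circle_int hf.1 x r hr h h0 m).const_mul c)
    (circle_int husc x r hr h (fun y hy => ereal_scale_nonpos c hc (h0 y hy)) m) ?_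
  intro θ _
  exact trunc_scale c hc _ (h0 _ (h (circle_mem x r θ hr))) m

variable {E : Type*} [NormedAddCommGroup E] [NormedSpace ℂ E]

/-- Competitors in the definition of `bndExt`. -/
def Competitor (A D : Set E) (u : E → EReal) : Prop :=
  MemPSH u D ∧ (∀ y ∈ D, u y ≤ 0) ∧ (∀ x ∈ A, uscReg u D x ≤ -1)

lemma Competitor.le {A D : Set E} {u : E → EReal} (h : Competitor A D u) (z : E) :
    u z ≤ bndExt z A D :=
  le_sSup ⟨u, h.1, h.2.1, h.2.2, rfl⟩

lemma bndExt_le {A D : Set E} {z : E} {S : EReal} (h : ∀ u, Competitor A D u → u z ≤ S) :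
    bndExt z A D ≤ S := by
  apply sSup_le
  rintro w ⟨u, h1, h2, h3, rfl⟩
  exact h u ⟨h1, h2, h3⟩

lemma bndExt_anti {A B D : Set E} (h : A ⊆ B) (z : E) : bndExt z B D ≤ bndExt z A D :=
  bndExt_le fun _ hu => Competitor.le ⟨hu.1, hu.2.1, fun x hx => hu.2.2 x (h hx)⟩ z

lemma competitor_const {A D : Set E} (hD : D.Nonempty) :
    Competitor A D (fun _ => (-1 : EReal)) := by
  have e : (-1 : EReal) = ((-1 : ℝ) : EReal) := by simp
  have hl : (-1 : EReal) ≤ 0 := by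
    rw [e, ← EReal.coe_zero, EReal.coe_le_coe_iff]; norm_num
  refine ⟨⟨⟨upperSemicontinuousOn_const, fun _ _ => ?_, fun a b =>
    ⟨upperSemicontinuousOn_const, fun c r hr h m => ?_⟩⟩, ?_⟩, fun _ _ => hl, fun x _ => ?_⟩
  · rw [e]; exact EReal.coe_ne_top _
  · have : (-1 : ℝ) ≤ (max (-1) ((-(m : ℝ) : ℝ) : EReal)).toReal := by
      rw [← EReal.coe_le_coe_iff, trunc_coe _ hl, ← e]
      exact le_max_left _ _
    unfold truncCircleAvg
    dsimp only
    rw [intervalIntegral.integral_const, sub_zero, smul_eq_mul, ← mul_assoc,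
      inv_mul_cancel₀ (by positivity), one_mul]
    rw [e] at this ⊢
    exact_mod_cast this
  · obtain ⟨z, hz⟩ := hD
    exact ⟨z, hz, by rw [e]; exact EReal.coe_ne_bot _⟩
  · unfold uscReg
    exact limsup_le_of_le (by isBoundedDefault) (Eventually.of_forall fun _ => le_rfl)

/-- Scaling constants. -/
noncomputable def scl (k : ℕ) : ℝ := 1 + 1 / ((k : ℝ) + 1)

lemma one_lt_scl (k : ℕ) : 1 < scl k := by
  unfold scl
  have : 0 < 1 / ((k : ℝ) + 1) := by positivity
  linarith

lemma scl_anti : Antitone scl := by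
  intro a b h
  unfold scl
  gcongr

lemma scl_tendsto : Tendsto scl atTop (𝓝 1) := by
  have := (tendsto_one_div_add_atTop_nhds_zero_nat (𝕜 := ℝ)).const_add 1
  rw [add_zero] at this
  exact this

lemma scl_mul_tendsto (y : EReal) :
    Tendsto (fun k => (scl k : EReal) * y) atTop (𝓝 y) := by
  have h : Tendsto (fun k => (scl k : EReal)) atTop (𝓝 (1 : EReal)) := by
    have := (continuous_coe_real_ereal.tendsto 1).comp scl_tendsto
    simpa using! this
  have := EReal.Tendsto.mul_const (b := y) h (Or.inl one_ne_zero) (Or.inl one_ne_zero)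
  simpa using this

/-- Open set on which `u` is strictly controlled. -/
def nbd (D : Set E) (u : E → EReal) (k : ℕ) : Set E :=
  {x | ∀ᶠ y in 𝓝[D] x, (scl k : EReal) * u y ≤ -1}

lemma nbd_open (D : Set E) (u : E → EReal) (k : ℕ) : IsOpen (nbd D u k) := by
  rw [isOpen_iff_mem_nhds]
  intro x hx
  have hx : ∀ᶠ y in 𝓝[D] x, (scl k : EReal) * u y ≤ -1 := hx
  rw [eventually_nhdsWithin_iff] at hx
  filter_upwards [hx.eventually_nhds] with y hy
  exact eventually_nhdsWithin_iff.2 hy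

lemma subset_nbd {A D : Set E} {u : E → EReal} (h : Competitor A D u) (k : ℕ) :
    A ⊆ nbd D u k := by
  intro x hx
  have h1 : uscReg u D x < ((-(scl k)⁻¹ : ℝ) : EReal) := by
    refine (h.2.2 x hx).trans_lt ?_
    have e : (-1 : EReal) = ((-1 : ℝ) : EReal) := by simp
    rw [e, EReal.coe_lt_coe_iff]
    have := inv_lt_one_of_one_lt₀ (one_lt_scl k)
    linarith
  have h2 := eventually_lt_of_limsup_lt h1 (by isBoundedDefault)
  refine h2.mono fun y hy => ?_
  have := ereal_scale_mono (scl k) (one_lt_scl k).le hy.le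
  refine this.trans ?_
  dsimp only
  rw [← EReal.coe_mul, mul_neg, mul_inv_cancel₀ (by have := one_lt_scl k; linarith)]
  simp

lemma nbd_anti {D : Set E} {u : E → EReal} (h0 : ∀ y ∈ D, u y ≤ 0) : Antitone (nbd D u) := by
  intro a b hab x hx
  have hx : ∀ᶠ y in 𝓝[D] x, (scl b : EReal) * u y ≤ -1 := hx
  show ∀ᶠ y in 𝓝[D] x, (scl a : EReal) * u y ≤ -1
  filter_upwards [hx, self_mem_nhdsWithin] with y hy hyD
  refine le_trans ?_ hy
  have h1 := EReal.neg_nonneg.2 (h0 y hyD)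
  have h2 := mul_le_mul_of_nonneg_right (EReal.coe_le_coe_iff.2 (scl_anti hab)) h1
  rw [mul_neg, mul_neg] at h2
  exact EReal.neg_le_neg_iff.1 h2

lemma competitor_scale {A D B : Set E} {u : E → EReal} (h : Competitor A D u) (k : ℕ)
    (hB : B ⊆ nbd D u k) : Competitor B D (fun y => (scl k : EReal) * u y) := by
  have hc := (one_lt_scl k).le
  obtain ⟨⟨⟨hu, ht, hs⟩, z, hz, hzb⟩, h0, hA⟩ := h
  refine ⟨⟨⟨(ereal_scale_cont _ hc).comp_upperSemicontinuousOn hu (ereal_scale_mono _ hc),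
    fun y hy => ?_, fun a b => subharmonic_scale (hs a b) (fun x hx => h0 _ hx) _ hc⟩,
    z, hz, ?_⟩, fun y hy => ereal_scale_nonpos _ hc (h0 y hy), fun x hx => ?_⟩
  · exact ((ereal_scale_nonpos _ hc (h0 y hy)).trans_lt EReal.zero_lt_top).ne
  · have hzt := ht z hz
    lift u z to ℝ using ⟨hzt, hzb⟩ with w
    rw [← EReal.coe_mul]
    exact EReal.coe_ne_bot _
  · exact limsup_le_of_le (by isBoundedDefault) (hB hx)

end aux

section aux2

open scoped ENNReal

/-- Normalized truncation of `u`, extended by zero outside `D`. -/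
noncomputable def normTrunc {E : Type*} (D : Set E) (u : E → EReal) : E → ℝ≥0∞ :=
  D.indicator fun z => ENNReal.ofReal ((max (u z) ((-((1 : ℕ) : ℝ) : ℝ) : EReal)).toReal + 1)

lemma normTrunc_meas {E : Type*} [TopologicalSpace E] [MeasurableSpace E] [BorelSpace E]
    {D : Set E} (hD : IsOpen D) {u : E → EReal}
    (hu : UpperSemicontinuousOn u D) : Measurable (normTrunc D u) := by
  refine measurable_of_restrict_of_restrict_compl hD.measurableSet ?_ ?_
  · have h1 : Measurable (D.domRestrict u) :=
      (upperSemicontinuousOn_iff_restrict.2 hu).measurable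
    have h2 : Measurable fun x : D =>
        ENNReal.ofReal ((max (D.domRestrict u x) ((-((1 : ℕ) : ℝ) : ℝ) : EReal)).toReal + 1) :=
      (((h1.max measurable_const).ereal_toReal).add_const 1).ennreal_ofReal
    convert h2 using 1
    ext x
    simp [normTrunc]
  · have : Dᶜ.domRestrict (normTrunc D u) = fun _ => 0 := by
      ext x
      have : (x : E) ∉ D := x.2
      simp [normTrunc, this]
    rw [this]
    exact measurable_const

lemma normTrunc_le {E : Type*} {D : Set E} {u : E → EReal} (h0 : ∀ y ∈ D, u y ≤ 0) :
    normTrunc D u ≤ D.indicator 1 := by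
  intro z
  by_cases hz : z ∈ D
  · simp only [normTrunc, indicator_of_mem hz, Pi.one_apply]
    rw [ENNReal.ofReal_le_one]
    linarith [trunc_le_zero _ (h0 z hz) 1]
  · simp [normTrunc, hz]

lemma circ_submean {E : Type*} [NormedAddCommGroup E] [NormedSpace ℂ E] {D : Set E}
    {u : E → EReal} (hu : PshOn u D) (h0 : ∀ y ∈ D, u y ≤ 0) (z w : E)
    (h : ∀ ζ : ℂ, ‖ζ‖ ≤ 1 → z + ζ • w ∈ D) :
    ENNReal.ofReal (2 * Real.pi) * normTrunc D u z ≤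
      ∫⁻ θ in Ioc (0 : ℝ) (2 * Real.pi), normTrunc D u (z + Complex.exp (θ * Complex.I) • w) := by
  have hz : z ∈ D := by simpa using h 0 (by simp)
  have hb : closedBall (0 : ℂ) 1 ⊆ {ζ : ℂ | z + ζ • w ∈ D} := by
    intro ζ hζ
    exact h ζ (by simpa using hζ)
  have hs := (hu.2.2 z w).2 0 1 one_pos hb 1
  have hi := circle_int (hu.2.2 z w).1 0 1 one_pos hb (fun x hx => h0 _ hx) 1
  unfold truncCircleAvg at hs
  simp only [zero_smul, add_zero, zero_add, Complex.ofReal_one, one_mul] at hs hi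
  set T : ℝ → ℝ := fun θ =>
    (max (u (z + Complex.exp (θ * Complex.I) • w)) ((-((1 : ℕ) : ℝ) : ℝ) : EReal)).toReal with hT
  have hc : ∀ θ : ℝ, z + Complex.exp (θ * Complex.I) • w ∈ D := fun θ =>
    h _ (by rw [Complex.norm_exp_ofReal_mul_I])
  have hpi : 0 < 2 * Real.pi := by positivity
  have hT1 : ∀ θ, -1 ≤ T θ := fun θ => by
    have := le_trunc _ (h0 _ (hc θ)) 1
    have e : (-((1 : ℕ) : ℝ)) = -1 := by simp
    exact e ▸ this
  have hI : IntervalIntegrable (fun θ => T θ + 1) volume 0 (2 * Real.pi) :=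
    hi.add intervalIntegrable_const
  have e1 : ∫ θ in (0 : ℝ)..(2 * Real.pi), (T θ + 1) =
      (∫ θ in (0 : ℝ)..(2 * Real.pi), T θ) + 2 * Real.pi := by
    rw [intervalIntegral.integral_add hi intervalIntegrable_const]
    simp
  have hnn : 0 ≤ ∫ θ in (0 : ℝ)..(2 * Real.pi), (T θ + 1) :=
    intervalIntegral.integral_nonneg hpi.le fun θ _ => by linarith [hT1 θ]
  have key : (max (u z) ((-((1 : ℕ) : ℝ) : ℝ) : EReal)).toReal ≤
      (2 * Real.pi)⁻¹ * ∫ θ in (0 : ℝ)..(2 * Real.pi), T θ := by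
    rw [← EReal.coe_le_coe_iff, trunc_coe _ (h0 z hz)]
    refine max_le hs ?_
    rw [EReal.coe_le_coe_iff, inv_mul_eq_div, le_div_iff₀ hpi]
    push_cast
    linarith
  have key2 : 2 * Real.pi * ((max (u z) ((-((1 : ℕ) : ℝ) : ℝ) : EReal)).toReal + 1) ≤
      ∫ θ in (0 : ℝ)..(2 * Real.pi), (T θ + 1) := by
    rw [inv_mul_eq_div, le_div_iff₀ hpi] at key
    rw [e1]
    linarith
  rw [normTrunc, indicator_of_mem hz, ← ENNReal.ofReal_mul hpi.le]
  refine (ENNReal.ofReal_le_ofReal key2).trans ?_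
  rw [intervalIntegral.integral_of_le hpi.le, ofReal_integral_eq_lintegral_ofReal
    ((intervalIntegrable_iff_integrableOn_Ioc_of_le hpi.le).1 hI)
    (Eventually.of_forall fun θ => by have := hT1 θ; simp only [Pi.zero_apply]; linarith)]
  refine lintegral_mono fun θ => ?_
  rw [indicator_of_mem (hc θ)]

lemma rot_lintegral {n : ℕ} {H : (Fin n → ℂ) → ℝ≥0∞} (hH : Measurable H) (z : Fin n → ℂ)
    (r θ : ℝ) :
    ∫⁻ w in closedBall 0 r, H (z + Complex.exp (θ * Complex.I) • w) =
      ∫⁻ y in closedBall z r, H y := by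
  have hrot : MeasurePreserving (fun w : Fin n → ℂ => Complex.exp (θ * Complex.I) • w) := by
    have := volume_preserving_pi (fun _ : Fin n => (rotation (Circle.exp θ)).measurePreserving)
    convert this using 1
    ext w i
    simp [rotation_apply, Circle.coe_exp]
  have hφ : MeasurePreserving (fun w : Fin n → ℂ => z + Complex.exp (θ * Complex.I) • w) :=
    (measurePreserving_add_left volume z).comp hrot
  have hp : (fun w : Fin n → ℂ => z + Complex.exp (θ * Complex.I) • w) ⁻¹' closedBall z r =
      closedBall 0 r := by
    ext w
    simp [norm_smul, Complex.norm_exp_ofReal_mul_I]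
  rw [← hφ.setLIntegral_comp_preimage measurableSet_closedBall hH, hp]

lemma ball_submean {n : ℕ} {D : Set (Fin n → ℂ)} (hD : IsOpen D)
    {u : (Fin n → ℂ) → EReal} (hu : PshOn u D) (h0 : ∀ y ∈ D, u y ≤ 0) (z : Fin n → ℂ) (r : ℝ)
    (hr : closedBall z r ⊆ D) :
    normTrunc D u z * volume (closedBall z r) ≤ ∫⁻ y in closedBall z r, normTrunc D u y := by
  have hm := normTrunc_meas hD hu.1
  have hpi : 0 < 2 * Real.pi := by positivity
  have hv : volume (closedBall z r) = volume (closedBall (0 : Fin n → ℂ) r) := by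
    have := rot_lintegral (H := fun _ => 1) measurable_const z r 0
    simpa using this.symm
  have h1 : ENNReal.ofReal (2 * Real.pi) * (normTrunc D u z * volume (closedBall z r)) ≤
      ENNReal.ofReal (2 * Real.pi) * ∫⁻ y in closedBall z r, normTrunc D u y := by
    calc _ = ∫⁻ _ in closedBall (0 : Fin n → ℂ) r,
          ENNReal.ofReal (2 * Real.pi) * normTrunc D u z := by
          rw [setLIntegral_const, hv, mul_assoc]
      _ ≤ ∫⁻ w in closedBall (0 : Fin n → ℂ) r, ∫⁻ θ in Ioc (0 : ℝ) (2 * Real.pi),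
            normTrunc D u (z + Complex.exp (θ * Complex.I) • w) := by
          refine setLIntegral_mono' measurableSet_closedBall fun w hw => ?_
          refine circ_submean hu h0 z w fun ζ hζ => hr ?_
          have hw' : ‖w‖ ≤ r := by simpa using hw
          rw [mem_closedBall, dist_eq_norm, add_sub_cancel_left, norm_smul]
          nlinarith [norm_nonneg w]
      _ = ∫⁻ θ in Ioc (0 : ℝ) (2 * Real.pi), ∫⁻ w in closedBall (0 : Fin n → ℂ) r,
            normTrunc D u (z + Complex.exp (θ * Complex.I) • w) := by
          apply lintegral_lintegral_swap
          have : Continuous fun p : (Fin n → ℂ) × ℝ =>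
              z + Complex.exp (p.2 * Complex.I) • p.1 := by fun_prop
          exact (hm.comp this.measurable).aemeasurable
      _ = ∫⁻ _ in Ioc (0 : ℝ) (2 * Real.pi), ∫⁻ y in closedBall z r, normTrunc D u y := by
          simp only [rot_lintegral hm]
      _ = _ := by
          rw [setLIntegral_const, Real.volume_Ioc, sub_zero, mul_comm]
  rwa [ENNReal.mul_le_mul_iff_right (by simpa using Real.pi_pos) ENNReal.ofReal_ne_top] at h1

lemma exists_seq_ess {X ι : Type*} [MeasurableSpace X] {μ : Measure X} [Nonempty ι]
    (h : ι → X → ℝ≥0∞) (hm : ∀ i, Measurable (h i)) (g : X → ℝ≥0∞) (hg : ∀ i, h i ≤ g)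
    (hgi : ∫⁻ x, g x ∂μ ≠ ∞) :
    ∃ s : ℕ → ι, ∀ i, h i ≤ᵐ[μ] fun x => ⨆ k, h (s k) x := by
  let Φ : (ℕ → ι) → ℝ≥0∞ := fun s => ∫⁻ x, ⨆ k, h (s k) x ∂μ
  obtain ⟨a, -, ha, hmem⟩ := exists_seq_tendsto_sSup (S := range Φ) (range_nonempty _)
    (OrderTop.bddAbove _)
  choose t ht using hmem
  let s : ℕ → ι := fun k => t k.unpair.1 k.unpair.2
  have hs : ∀ j, Φ (t j) ≤ Φ s := fun j => lintegral_mono fun x => iSup_le fun k => by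
    have : s (Nat.pair j k) = t j k := by simp [s]
    rw [← this]
    exact le_iSup (fun k => h (s k) x) (Nat.pair j k)
  have hmax : ∀ s', Φ s' ≤ Φ s := fun s' => by
    refine (le_sSup (mem_range_self s')).trans ?_
    exact le_of_tendsto' ha fun j => by rw [← ht j]; exact hs j
  refine ⟨s, fun i => ?_⟩
  let s' : ℕ → ι := fun k => Nat.casesOn k i s
  have hle : ∀ x, ⨆ k, h (s k) x ≤ ⨆ k, h (s' k) x := fun x => iSup_le fun k =>
    le_iSup (fun k => h (s' k) x) (k + 1)
  have hfin : Φ s ≠ ∞ := by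
    refine ne_top_of_le_ne_top hgi (lintegral_mono fun x => iSup_le fun k => hg _ x)
  have := ae_eq_of_ae_le_of_lintegral_le (Eventually.of_forall hle) hfin
    (Measurable.iSup fun k => hm (s' k)).aemeasurable (hmax s')
  filter_upwards [this] with x hx
  rw [hx]
  exact le_iSup (fun k => h (s' k) x) 0

/-- A countable family of competitors dominates almost everywhere all competitors. -/
lemma exists_countable_family {n : ℕ} (D A : Set (Fin n → ℂ)) (hD : IsBddDomain D) :
    ∃ s : ℕ → (Fin n → ℂ) → EReal, (∀ k, Competitor A D (s k)) ∧
      ∀ᵐ z, z ∈ D → ∀ u, Competitor A D u → normTrunc D u z ≤ ⨆ k, normTrunc D (s k) z := by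
  obtain ⟨hDo, hDc, hDb⟩ := hD
  have : Nonempty {u // Competitor A D u} := ⟨⟨_, competitor_const hDc.nonempty⟩⟩
  have hgi : ∫⁻ x, D.indicator (1 : (Fin n → ℂ) → ℝ≥0∞) x ≠ ∞ := by
    rw [lintegral_indicator_one hDo.measurableSet]
    exact hDb.measure_lt_top.ne
  obtain ⟨s, hs⟩ := exists_seq_ess (μ := (volume : Measure (Fin n → ℂ)))
    (fun u : {u // Competitor A D u} => normTrunc D u.1)
    (fun u => normTrunc_meas hDo u.2.1.1.1) (D.indicator 1) (fun u => normTrunc_le u.2.2.1) hgi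
  refine ⟨fun k => (s k).1, fun k => (s k).2, ?_⟩
  set v : (Fin n → ℂ) → ℝ≥0∞ := fun x => ⨆ k, normTrunc D (s k).1 x with hv
  have hvm : Measurable v := Measurable.iSup fun k => normTrunc_meas hDo (s k).2.1.1.1
  have hvi : ∫⁻ x, v x ≠ ∞ := ne_top_of_le_ne_top hgi
    (lintegral_mono fun x => iSup_le fun k => normTrunc_le (s k).2.2.1 x)
  filter_upwards [(Besicovitch.vitaliFamily (volume : Measure (Fin n → ℂ))).ae_tendsto_lintegral_div
    hvm.aemeasurable hvi] with z hz hzD u hu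
  have ht := hz.comp (Besicovitch.tendsto_filterAt volume z)
  refine ge_of_tendsto ht ?_
  obtain ⟨ε, hε, hball⟩ := Metric.isOpen_iff.1 hDo z hzD
  filter_upwards [Ioo_mem_nhdsGT hε] with r hr
  have hsub : closedBall z r ⊆ D := (closedBall_subset_ball hr.2).trans hball
  simp only [Function.comp]
  rw [ENNReal.le_div_iff_mul_le (Or.inl (measure_closedBall_pos volume z hr.1).ne')
    (Or.inl measure_closedBall_lt_top.ne)]
  refine (ball_submean hDo hu.1.1 hu.2.1 z r hsub).trans ?_
  exact lintegral_mono_ae (ae_restrict_of_ae (hs ⟨u, hu⟩))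

end aux2

/-- `ω(z, A, D)` is the supremum of `ω(z, V, D)` over relatively open
neighborhoods `V` of `A` in `∂D`, and there is a non-increasing sequence `(V j)` of such
neighborhoods with `ω(z, V j, D) → ω(z, A, D)` for Lebesgue-almost every `z ∈ D`. -/
theorem bndExt_eq_sSup_open_nbhds {n : ℕ} (D A : Set (Fin n → ℂ))
    (hD : IsBddDomain D) (hA : A ⊆ frontier D) :
    (∀ z ∈ D, bndExt z A D =
      sSup {w : EReal | ∃ V W : Set (Fin n → ℂ), IsOpen W ∧ V = W ∩ frontier D ∧
        A ⊆ V ∧ w = bndExt z V D}) ∧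
    ∃ V : ℕ → Set (Fin n → ℂ),
      (∀ j, ∃ W : Set (Fin n → ℂ), IsOpen W ∧ V j = W ∩ frontier D) ∧
      (∀ j, A ⊆ V j) ∧ Antitone V ∧
      ∀ᵐ z, z ∈ D →
        Tendsto (fun j => bndExt z (V j) D) atTop (𝓝 (bndExt z A D)) := by
  constructor
  · intro z _
    apply le_antisymm
    · refine bndExt_le fun u hu => ?_
      refine le_of_tendsto' (scl_mul_tendsto (u z)) fun k => ?_
      refine le_trans ?_ (le_sSup ⟨nbd D u k ∩ frontier D, nbd D u k, nbd_open D u k, rfl,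
        subset_inter (subset_nbd hu k) hA, rfl⟩)
      exact (competitor_scale hu k inter_subset_left).le z
    · apply sSup_le
      rintro w ⟨V, W, -, -, hV, rfl⟩
      exact bndExt_anti hV z
  · obtain ⟨s, hs, hae⟩ := exists_countable_family D A hD
    let W : ℕ → Set (Fin n → ℂ) := fun j => ⋂ i ∈ Iic j, nbd D (s i) j
    have hWV : ∀ i j, i ≤ j → W j ∩ frontier D ⊆ nbd D (s i) j := fun i j hij x hx =>
      mem_iInter₂.1 hx.1 i hij
    refine ⟨fun j => W j ∩ frontier D, fun j => ⟨W j, ?_, rfl⟩, fun j => ?_, ?_, ?_⟩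
    · exact (finite_Iic j).isOpen_biInter fun i _ => nbd_open D (s i) j
    · exact subset_inter (subset_iInter₂ fun i _ => subset_nbd (hs i) j) hA
    · intro a b hab x hx
      refine ⟨mem_iInter₂.2 fun i hi => ?_, hx.2⟩
      exact nbd_anti (hs i).2.1 hab (mem_iInter₂.1 hx.1 i (le_trans hi hab))
    · have hAV : ∀ j, A ⊆ W j ∩ frontier D := fun j =>
        subset_inter (subset_iInter₂ fun i _ => subset_nbd (hs i) j) hA
      have hanti : Antitone fun j => W j ∩ frontier D := by
        intro a b hab x hx
        refine ⟨mem_iInter₂.2 fun i hi => ?_, hx.2⟩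
        exact nbd_anti (hs i).2.1 hab (mem_iInter₂.1 hx.1 i (le_trans hi hab))
      filter_upwards [hae] with z hz hzD
      have hmono : Monotone fun j => bndExt z (W j ∩ frontier D) D := fun a b hab =>
        bndExt_anti (hanti hab) z
      have hlim := tendsto_atTop_iSup hmono
      set S : EReal := ⨆ j, bndExt z (W j ∩ frontier D) D with hS
      have hSle : S ≤ bndExt z A D := iSup_le fun j => bndExt_anti (hAV j) z
      have hS0 : S ≤ 0 := hSle.trans (bndExt_le fun u hu => hu.2.1 z hzD)
      have hS1 : ((-((1 : ℕ) : ℝ) : ℝ) : EReal) ≤ S := by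
        have h1 := (competitor_const (A := W 0 ∩ frontier D) hD.2.1.nonempty).le z
        have h2 := h1.trans (le_iSup (fun j => bndExt z (W j ∩ frontier D) D) 0)
        simpa using! h2
      have hsS : ∀ i, s i z ≤ S := fun i => by
        refine le_of_tendsto (scl_mul_tendsto (s i z)) ?_
        filter_upwards [eventually_ge_atTop i] with j hj
        exact ((competitor_scale (hs i) j (hWV i j hj)).le z).trans
          (le_iSup (fun j => bndExt z (W j ∩ frontier D) D) j)
      have hSr : ((S.toReal : ℝ) : EReal) = S := EReal.coe_toReal
        (hS0.trans_lt EReal.zero_lt_top).ne ((EReal.bot_lt_coe _).trans_le hS1).ne'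
      have hS1r : -1 ≤ S.toReal := by
        rw [← hSr, EReal.coe_le_coe_iff] at hS1
        simpa using hS1
      have hle : bndExt z A D ≤ S := by
        refine bndExt_le fun u hu => ?_
        have h1 : normTrunc D u z ≤ ENNReal.ofReal (S.toReal + 1) := by
          refine (hz hzD u hu).trans (iSup_le fun k => ?_)
          rw [normTrunc, indicator_of_mem hzD]
          refine ENNReal.ofReal_le_ofReal ?_
          have : (max (s k z) ((-((1 : ℕ) : ℝ) : ℝ) : EReal)).toReal ≤ S.toReal := by
            rw [← EReal.coe_le_coe_iff, trunc_coe _ ((hs k).2.1 z hzD), hSr]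
            exact max_le (hsS k) hS1
          linarith
        rw [normTrunc, indicator_of_mem hzD, ENNReal.ofReal_le_ofReal_iff (by linarith)] at h1
        have h2 : (max (u z) ((-((1 : ℕ) : ℝ) : ℝ) : EReal)).toReal ≤ S.toReal := by linarith
        rw [← EReal.coe_le_coe_iff, trunc_coe _ (hu.2.1 z hzD), hSr] at h2
        exact (le_max_left _ _).trans h2
      rw [le_antisymm hle hSle]
      exact hlim
end

section
/- Let D ⊆ ℂⁿ be a weakly regular bounded domain and let A ⊆ ∂D be relatively open in ∂D. Then ω(z, A, D) = ω*(z, A, D) for every z ∈ D; in particular ω(·, A, D) is plurisubharmonic on D. -/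
open Complex Metric MeasureTheory Filter Topology Set

noncomputable section Helpers

variable {F : Type*} [NormedAddCommGroup F] [NormedSpace ℂ F]

/-- The continuous antitone truncation of `-t`, with values in `[0, ∞]`. -/
def psiT (m : ℕ) (t : EReal) : ENNReal :=
  (-(max t ((-(m : ℝ) : ℝ) : EReal))).toENNReal

theorem psiT_antitone (m : ℕ) : Antitone (psiT m) := by
  intro s t h
  apply EReal.toENNReal_le_toENNReal
  rw [EReal.neg_le_neg_iff]
  exact max_le_max_right _ h

theorem psiT_continuous (m : ℕ) : Continuous (psiT m) := by
  unfold psiT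
  exact EReal.continuous_toENNReal.comp (continuous_neg.comp (continuous_id.max continuous_const))

theorem psiT_le (m : ℕ) (t : EReal) : psiT m t ≤ ENNReal.ofReal m := by
  have : psiT m t ≤ psiT m ⊥ := psiT_antitone m bot_le
  refine this.trans ?_
  unfold psiT
  rw [max_eq_right bot_le, ← EReal.coe_neg, EReal.real_coe_toENNReal]
  simp

theorem psiT_toReal (m : ℕ) (t : EReal) (ht : t ≤ 0) :
    (max t ((-(m : ℝ) : ℝ) : EReal)).toReal = -(psiT m t).toReal := by
  unfold psiT
  have h0 : max t ((-(m : ℝ) : ℝ) : EReal) ≤ 0 := by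
    refine max_le ht ?_
    exact_mod_cast (neg_nonpos.mpr (Nat.cast_nonneg m) : -(m : ℝ) ≤ 0)
  rw [EReal.toReal_toENNReal, EReal.toReal_neg_eq, neg_neg]
  have := EReal.neg_le_neg_iff.mpr h0
  rwa [neg_zero] at this

/-- The lower integral of the truncation over a circle in a complex line. -/
def lcirc (v : ℝ → EReal) (m : ℕ) : ENNReal :=
  ∫⁻ θ in Ioc (0:ℝ) (2 * Real.pi), psiT m (v θ)

theorem lcirc_ne_top (v : ℝ → EReal) (m : ℕ) : lcirc v m ≠ ⊤ := by
  have : lcirc v m ≤ ∫⁻ θ in Ioc (0:ℝ) (2 * Real.pi), ENNReal.ofReal m :=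
    lintegral_mono fun θ => psiT_le m _
  refine ne_top_of_le_ne_top ?_ this
  rw [lintegral_const]
  simp [ENNReal.mul_eq_top]

theorem truncCircleAvg_eq (u : ℂ → EReal) (c : ℂ) (r : ℝ) (m : ℕ)
    (hm : Measurable fun θ : ℝ => u (c + (r : ℂ) * Complex.exp (θ * Complex.I)))
    (h0 : ∀ θ : ℝ, u (c + (r : ℂ) * Complex.exp (θ * Complex.I)) ≤ 0) :
    truncCircleAvg u c r m = (2 * Real.pi)⁻¹ *
      -(lcirc (fun θ : ℝ => u (c + (r : ℂ) * Complex.exp (θ * Complex.I))) m).toReal := by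
  unfold truncCircleAvg lcirc
  congr 1
  rw [intervalIntegral.integral_of_le (by positivity)]
  rw [← integral_toReal, ← integral_neg]
  · congr 1; ext θ; exact psiT_toReal m _ (h0 θ)
  · exact ((psiT_continuous m).measurable.comp hm).aemeasurable
  · exact ae_of_all _ fun θ => (psiT_le m _).trans_lt ENNReal.ofReal_lt_top

theorem circ_mem (r : ℝ) (hr : 0 < r) (c : ℂ) (θ : ℝ) :
    c + (r : ℂ) * Complex.exp (θ * Complex.I) ∈ Metric.closedBall c r := by
  simp [Complex.norm_exp_ofReal_mul_I, abs_of_pos hr]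

theorem meas_circ {u : F → EReal} {D : Set F} (hu : UpperSemicontinuousOn u D) (z b : F) (r : ℝ)
    (h : ∀ θ : ℝ, z + ((r : ℂ) * Complex.exp (θ * Complex.I)) • b ∈ D) :
    Measurable fun θ : ℝ => u (z + ((r : ℂ) * Complex.exp (θ * Complex.I)) • b) := by
  apply UpperSemicontinuous.measurable
  rw [← upperSemicontinuousOn_univ_iff]
  refine UpperSemicontinuousOn.comp (g := fun θ : ℝ =>
    z + ((r : ℂ) * Complex.exp (θ * Complex.I)) • b) hu ?_ (fun θ _ => h θ)
  fun_prop

theorem pshOn_congr {u v : F → EReal} {D : Set F} (h : ∀ z ∈ D, u z = v z) (hv : PshOn v D) :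
    PshOn u D := by
  have key : ∀ {X : Type _} [TopologicalSpace X] (f g : X → EReal) (S : Set X),
      (∀ x ∈ S, f x = g x) → UpperSemicontinuousOn g S → UpperSemicontinuousOn f S := by
    intro X _ f g S hfg hg x hx y hy
    have hy' : f x < y := hy
    rw [hfg x hx] at hy'
    filter_upwards [hg x hx y hy', self_mem_nhdsWithin] with x' h1 h2
    show f x' < y
    rw [hfg x' h2]; exact h1
  obtain ⟨h1, h2, h3⟩ := hv
  refine ⟨key u v D h h1, fun z hz => by rw [h z hz]; exact h2 z hz, fun a b => ?_⟩
  refine ⟨?_, ?_⟩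
  · intro x hx y hy
    have hy' : u (a + x • b) < y := hy
    rw [h _ hx] at hy'
    filter_upwards [(h3 a b).1 x hx y hy', self_mem_nhdsWithin] with x' h1 h2
    show u (a + x' • b) < y
    rw [h _ h2]; exact h1
  · intro c r hr hb m
    have := (h3 a b).2 c r hr hb m
    have hc : a + c • b ∈ D := hb (mem_closedBall_self hr.le)
    show u (a + c • b) ≤ _
    rw [h _ hc]
    refine this.trans_eq ?_
    congr 1
    unfold truncCircleAvg
    congr 1
    apply intervalIntegral.integral_congr
    intro θ _
    have := h _ (hb (circ_mem r hr c θ))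
    simp only [this]

theorem neg_one_coe : (-1 : EReal) = ((-1 : ℝ) : EReal) := by simp

theorem const_competitor (D : Set F) : PshOn (fun _ : F => (-1 : EReal)) D := by
  refine ⟨upperSemicontinuousOn_const, fun z _ => neg_one_coe ▸ EReal.coe_ne_top _, fun a b =>
    ⟨upperSemicontinuousOn_const, fun c r hr hb m => ?_⟩⟩
  unfold truncCircleAvg
  beta_reduce
  rw [intervalIntegral.integral_const, sub_zero, smul_eq_mul, ← mul_assoc,
    inv_mul_cancel₀ (by positivity), one_mul]
  rw [neg_one_coe, ← EReal.coe_strictMono.monotone.map_max, EReal.toReal_coe, EReal.coe_le_coe_iff]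
  exact le_max_left _ _

theorem neg_one_le_bndExt (A D : Set F) (hD : D.Nonempty) (z : F) : -1 ≤ bndExt z A D := by
  obtain ⟨d, hd⟩ := hD
  refine le_sSup ⟨fun _ => -1, ⟨const_competitor D, d, hd, neg_one_coe ▸ EReal.coe_ne_bot _⟩, fun _ _ => ?_, ?_, rfl⟩
  · show (-1 : EReal) ≤ 0
    rw [neg_one_coe]
    exact_mod_cast (by norm_num : (-1 : ℝ) ≤ 0)
  · intro x _
    exact limsup_le_of_le (by isBoundedDefault) (Eventually.of_forall fun _ => le_rfl)

theorem bndExt_nonpos (A D : Set F) {z : F} (hz : z ∈ D) : bndExt z A D ≤ 0 := by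
  apply sSup_le
  rintro w ⟨u, -, h, -, rfl⟩
  exact h z hz

theorem bndExtStar_nonpos (A D : Set F) (x : F) : bndExtStar x A D ≤ 0 := by
  refine limsup_le_of_le (by isBoundedDefault) ?_
  filter_upwards [self_mem_nhdsWithin] with z hz using bndExt_nonpos A D hz

theorem bndExt_le_star (A D : Set F) {z : F} (hz : z ∈ D) :
    bndExt z A D ≤ bndExtStar z A D := by
  refine le_limsup_of_frequently_le' ?_
  intro hne
  have := mem_of_mem_nhdsWithin hz hne
  exact this le_rfl

theorem star_eventually (A D : Set F) (x : F) {y : EReal} (hy : bndExtStar x A D < y) :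
    ∀ᶠ x' in 𝓝[D] x, bndExtStar x' A D < y := by
  obtain ⟨y', h1, h2⟩ := exists_between hy
  have := eventually_lt_of_limsup_lt h1
  rw [← eventually_eventually_nhdsWithin] at this
  filter_upwards [this] with x' hx'
  exact (limsup_le_of_le (by isBoundedDefault) (hx'.mono fun _ h => h.le)).trans_lt h2

theorem star_usc (A D : Set F) : UpperSemicontinuousOn (fun x => bndExtStar x A D) D :=
  fun x _ _ hy => star_eventually A D x hy

theorem star_limsup (A D : Set F) (x : F) :
    uscReg (fun x => bndExtStar x A D) D x ≤ bndExtStar x A D := by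
  refine le_of_forall_gt_imp_ge_of_dense fun y hy => ?_
  exact limsup_le_of_le (by isBoundedDefault) ((star_eventually A D x hy).mono fun _ h => h.le)

theorem bndExt_le_avg (A D : Set F) (z b : F) (r : ℝ) (hr : 0 < r)
    (hz : ∀ ζ ∈ Metric.closedBall (0 : ℂ) r, z + ζ • b ∈ D) (m : ℕ) :
    bndExt z A D ≤ (((2 * Real.pi)⁻¹ * -(lcirc (fun θ : ℝ =>
      bndExtStar (z + ((r : ℂ) * Complex.exp (θ * Complex.I)) • b) A D) m).toReal : ℝ) : EReal) := by
  have hP : ∀ θ : ℝ, z + ((r : ℂ) * Complex.exp (θ * Complex.I)) • b ∈ D := by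
    intro θ
    have := hz _ (circ_mem r hr 0 θ)
    rwa [zero_add] at this
  apply sSup_le
  rintro w ⟨u, hu, hu0, huA, rfl⟩
  have h1 := (hu.1.2.2 z b).2 0 r hr hz m
  rw [truncCircleAvg_eq] at h1
  · simp only [zero_smul, add_zero, zero_add] at h1
    refine h1.trans ?_
    rw [EReal.coe_le_coe_iff]
    refine mul_le_mul_of_nonneg_left ?_ (by positivity)
    rw [neg_le_neg_iff]
    refine ENNReal.toReal_mono (lcirc_ne_top _ _) ?_
    refine lintegral_mono fun θ => psiT_antitone m ?_
    refine le_trans ?_ (bndExt_le_star A D (hP θ))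
    exact le_sSup ⟨u, hu, hu0, huA, rfl⟩
  · simpa only [zero_add] using meas_circ hu.1.1 z b r hP
  · intro θ
    simpa only [zero_add] using hu0 _ (hP θ)

theorem star_psh (A D : Set F) (hD : IsOpen D) : PshOn (fun x => bndExtStar x A D) D := by
  refine ⟨star_usc A D, fun z _ h => ?_, fun a b => ⟨?_, ?_⟩⟩
  · have := bndExtStar_nonpos A D z
    rw [show bndExtStar z A D = ⊤ from h] at this
    exact absurd this (by decide)
  · refine UpperSemicontinuousOn.comp (g := fun ζ : ℂ => a + ζ • b) (star_usc A D) ?_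
      (fun ζ h => h)
    fun_prop
  intro c r hr hb m
  set z0 := a + c • b with hz0
  have hline : ∀ w : ℂ, a + (c + w) • b = z0 + w • b := by
    intro w; rw [hz0, add_smul, add_assoc]
  have hz0D : ∀ ζ ∈ Metric.closedBall (0 : ℂ) r, z0 + ζ • b ∈ D := by
    intro ζ hζ
    rw [← hline]
    apply hb
    simpa using hζ
  have hev : ∀ᶠ z in 𝓝 z0, ∀ ζ ∈ Metric.closedBall (0 : ℂ) r, z + ζ • b ∈ D := by
    have := (isCompact_closedBall (0 : ℂ) r).eventually_forall_of_forall_eventually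
      (x₀ := z0) (P := fun z ζ => z + ζ • b ∈ D) (fun ζ hζ => by
        have hc : Continuous fun p : F × ℂ => p.1 + p.2 • b := by fun_prop
        exact (hD.preimage hc).mem_nhds (hz0D ζ hζ))
    exact this
  have hcirc : ∀ z : F, (∀ ζ ∈ Metric.closedBall (0 : ℂ) r, z + ζ • b ∈ D) →
      ∀ θ : ℝ, z + ((r : ℂ) * Complex.exp (θ * Complex.I)) • b ∈ D := by
    intro z hz θ
    have := hz _ (circ_mem r hr 0 θ)
    rwa [zero_add] at this
  rw [truncCircleAvg_eq]
  rotate_left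
  · simp only [hline]
    exact meas_circ (star_usc A D) z0 b r (hcirc z0 hz0D)
  · intro θ; exact bndExtStar_nonpos _ _ _
  simp only [hline]
  rw [← hz0]
  set L : F → ENNReal := fun z => lcirc (fun θ : ℝ =>
      bndExtStar (z + ((r : ℂ) * Complex.exp (θ * Complex.I)) • b) A D) m with hL
  change bndExtStar z0 A D ≤ (((2 * Real.pi)⁻¹ * -(L z0).toReal : ℝ) : EReal)
  refine le_of_forall_gt_imp_ge_of_dense fun y hy => ?_
  obtain ⟨q, hq1, hq2⟩ := EReal.lt_iff_exists_real_btwn.mp hy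
  rw [EReal.coe_lt_coe_iff] at hq1
  refine le_trans ?_ hq2.le
  suffices h : ∀ᶠ z in 𝓝 z0, (2 * Real.pi)⁻¹ * -(L z).toReal ≤ q by
    refine limsup_le_of_le (by isBoundedDefault) ?_
    filter_upwards [nhdsWithin_le_nhds hev, nhdsWithin_le_nhds h] with z h1 h2
    exact (bndExt_le_avg A D z b r hr h1 m).trans (EReal.coe_le_coe_iff.mpr h2)
  by_contra hcon
  have hfr : ∃ᶠ z in 𝓝 z0, (∀ ζ ∈ Metric.closedBall (0 : ℂ) r, z + ζ • b ∈ D) ∧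
      q < (2 * Real.pi)⁻¹ * -(L z).toReal := by
    have : ∃ᶠ z in 𝓝 z0, ¬ ((2 * Real.pi)⁻¹ * -(L z).toReal ≤ q) := not_eventually.mp hcon
    exact (this.and_eventually hev).mono fun z h => ⟨h.2, not_le.mp h.1⟩
  obtain ⟨s, hs, hsp⟩ := exists_seq_forall_of_frequently hfr
  have hpi : 0 < 2 * Real.pi := by positivity
  have hbound : ∀ n, (L (s n)).toReal ≤ -(2 * Real.pi * q) := by
    intro n
    have := (hsp n).2
    rw [inv_mul_eq_div, lt_div_iff₀ hpi] at this
    linarith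
  have hfatou : L z0 ≤ liminf (fun n => L (s n)) atTop := by
    refine le_trans ?_ (lintegral_liminf_le (u := atTop) (f := fun n θ => psiT m (bndExtStar
      (s n + ((r : ℂ) * Complex.exp ((θ : ℝ) * Complex.I)) • b) A D)) fun n =>
        (psiT_continuous m).measurable.comp
          (meas_circ (star_usc A D) (s n) b r (hcirc _ (hsp n).1)))
    refine lintegral_mono fun θ => ?_
    have h1 := (psiT_antitone m).map_limsup_of_continuousAt (F := atTop) (fun n : ℕ => bndExtStar
      (s n + ((r : ℂ) * Complex.exp ((θ : ℝ) * Complex.I)) • b) A D)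
      (psiT_continuous m).continuousAt
    refine le_trans (psiT_antitone m ?_) h1.le
    refine le_trans ?_ (star_limsup A D _)
    refine Tendsto.limsup_comp_le_limsup (u := fun x => bndExtStar x A D)
      (v := fun n => s n + ((r : ℂ) * Complex.exp ((θ : ℝ) * Complex.I)) • b) ?_
    rw [tendsto_nhdsWithin_iff]
    exact ⟨hs.add_const _, Eventually.of_forall fun n => hcirc _ (hsp n).1 θ⟩
  have h2 : liminf (fun n => L (s n)) atTop ≤ ENNReal.ofReal (-(2 * Real.pi * q)) := by
    refine liminf_le_of_frequently_le' (Eventually.frequently (Eventually.of_forall fun n => ?_))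
    exact (ENNReal.le_ofReal_iff_toReal_le (lcirc_ne_top _ _)
      (ENNReal.toReal_nonneg.trans (hbound n))).mpr (hbound n)
  have h3 : (L z0).toReal ≤ -(2 * Real.pi * q) :=
    (ENNReal.le_ofReal_iff_toReal_le (lcirc_ne_top _ _)
      (ENNReal.toReal_nonneg.trans (hbound 0))).mp (hfatou.trans h2)
  rw [inv_mul_eq_div, div_lt_iff₀ hpi] at hq1
  linarith

end Helpers

/-- If `D` is weakly regular and `A` is relatively open in `∂D`, then
`ω(·, A, D) = ω*(·, A, D)` on `D`; in particular `ω(·, A, D)` is plurisubharmonic on `D`. -/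
theorem bndExt_eq_bndExtStar_of_weaklyRegular {n : ℕ}
    (D A W : Set (EuclideanSpace ℂ (Fin n))) (hD : IsBddDomain D)
    (hreg : WeaklyRegular D) (hW : IsOpen W) (hA : A = W ∩ frontier D) :
    (∀ z ∈ D, bndExt z A D = bndExtStar z A D) ∧
    PshOn (fun z => bndExt z A D) D := by
  subst hA
  have hle : ∀ z ∈ D, bndExtStar z (W ∩ frontier D) D ≤ bndExt z (W ∩ frontier D) D := by
    intro z hz
    refine le_sSup ⟨fun x => bndExtStar x (W ∩ frontier D) D, ⟨star_psh _ D hD.1, z, hz, ?_⟩,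
      fun y _ => bndExtStar_nonpos _ _ _, fun x hx => ?_, rfl⟩
    · intro hbot
      have h1 := (neg_one_le_bndExt (W ∩ frontier D) D ⟨z, hz⟩ z).trans
        (bndExt_le_star (W ∩ frontier D) D hz)
      rw [show bndExtStar z (W ∩ frontier D) D = ⊥ from hbot] at h1
      exact absurd h1 (by decide)
    · exact (star_limsup _ D x).trans (hreg _ W hW rfl x hx)
  have heq : ∀ z ∈ D, bndExt z (W ∩ frontier D) D = bndExtStar z (W ∩ frontier D) D :=
    fun z hz => le_antisymm (bndExt_le_star _ D hz) (hle z hz)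
  exact ⟨heq, pshOn_congr heq (star_psh _ D hD.1)⟩
end

section
/- Let D ⊆ ℂⁿ be a B-regular bounded domain and A ⊆ ∂D. Then ω*(x, A, D) = 0 for every x ∈ ∂D that does not lie in the interior (relative to ∂D) of the closure of A. -/
open Complex Metric MeasureTheory Filter Topology Set

theorem psh_max_principle {n : ℕ} {D : Set (EuclideanSpace ℂ (Fin n))} (hD : IsBddDomain D)
    {F : EuclideanSpace ℂ (Fin n) → ℝ} (hF : ContinuousOn F (closure D))
    (hpsh : PshOn (fun z => ((F z : ℝ) : EReal)) D)
    {x : EuclideanSpace ℂ (Fin n)} (hx : x ∈ frontier D)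
    (hle : ∀ z ∈ frontier D, F z ≤ 0) : ∀ z ∈ D, F z ≤ 0 := by
  obtain ⟨hDo, -, hDb⟩ := hD
  have hcomp : IsCompact (closure D) := hDb.isCompact_closure
  intro z hz
  by_contra! hpos
  obtain ⟨q, hq, hqmax⟩ := hcomp.exists_isMaxOn ⟨z, subset_closure hz⟩ hF
  have hmax : ∀ y ∈ closure D, F y ≤ F q := fun y hy => hqmax hy
  have hM : 0 < F q := lt_of_lt_of_le hpos (hmax z (subset_closure hz))
  set M := F q with hMdef
  have hK : IsCompact (closure D ∩ F ⁻¹' {M}) :=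
    hcomp.of_isClosed_subset
      (hF.preimage_isClosed_of_isClosed isClosed_closure isClosed_singleton) inter_subset_left
  obtain ⟨p, ⟨hpc, hpM⟩, hpmax⟩ := hK.exists_isMaxOn ⟨q, hq, rfl⟩
    (f := fun y => dist y x) (by fun_prop)
  have hpM : F p = M := hpM
  have hpD : p ∈ D := by
    by_contra hp
    have : p ∈ frontier D := by rw [hDo.frontier_eq]; exact ⟨hpc, hp⟩
    have := hle p this
    linarith
  have hpx : p - x ≠ 0 := by
    intro h
    rw [sub_eq_zero] at h
    have := hle x hx
    rw [h] at hpM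
    linarith
  have hcont : Continuous (fun ζ : ℂ => p + ζ • (p - x)) := by fun_prop
  have hopen : IsOpen {ζ : ℂ | p + ζ • (p - x) ∈ D} := hDo.preimage hcont
  obtain ⟨r, hr, hball⟩ := Metric.nhds_basis_closedBall.mem_iff.1
    (hopen.mem_nhds (x := (0:ℂ)) (by simpa using hpD))
  have hsub := (hpsh.2.2 p (p - x)).2 0 r hr hball 0
  simp only [zero_smul, add_zero, zero_add, truncCircleAvg] at hsub
  have hcirc : ∀ θ : ℝ, p + ((r : ℂ) * Complex.exp (θ * Complex.I)) • (p - x) ∈ D := by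
    intro θ
    apply hball
    simp [Complex.norm_exp_ofReal_mul_I, abs_of_pos hr]
  set g : ℝ → ℝ := fun θ => F (p + ((r : ℂ) * Complex.exp (θ * Complex.I)) • (p - x)) with hg
  have hgc : Continuous g := by
    apply hF.comp_continuous (by fun_prop)
    intro θ
    exact subset_closure (hcirc θ)
  have hgM : ∀ θ, g θ ≤ M := fun θ => hmax _ (subset_closure (hcirc θ))
  have hint : ∀ θ : ℝ, (max ((g θ : ℝ) : EReal) ((-((0:ℕ) : ℝ) : ℝ) : EReal)).toReal
      = max (g θ) 0 := by
    intro θ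
    rw [← EReal.coe_strictMono.monotone.map_max, EReal.toReal_coe]
    simp
  have hsub' : M ≤ (2 * Real.pi)⁻¹ * ∫ θ in (0:ℝ)..(2 * Real.pi), max (g θ) 0 := by
    rw [← hpM]
    have := EReal.coe_le_coe_iff.1 hsub
    refine this.trans (le_of_eq ?_)
    congr 1
    exact intervalIntegral.integral_congr (fun θ _ => hint θ)
  have hpi : (0:ℝ) < 2 * Real.pi := by positivity
  have hg0 : g 0 = M := by
    by_contra hne
    have hlt : g 0 < M := lt_of_le_of_ne (hgM 0) hne
    have := intervalIntegral.integral_lt_integral_of_continuousOn_of_le_of_exists_lt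
      (f := fun θ => max (g θ) 0) (g := fun _ => M) hpi
      (by fun_prop) (by fun_prop) (fun θ _ => max_le (hgM θ) hM.le)
      ⟨0, ⟨le_refl _, hpi.le⟩, max_lt hlt hM⟩
    simp only [intervalIntegral.integral_const, sub_zero, smul_eq_mul] at this
    rw [inv_mul_eq_div, le_div_iff₀ hpi] at hsub'
    linarith
  have hc0 := hcirc 0
  simp only [hg, Complex.ofReal_zero, zero_mul, Complex.exp_zero, mul_one] at hg0 hc0
  have hfar : dist (p + (r : ℂ) • (p - x)) x ≤ dist p x := hpmax ⟨subset_closure hc0, hg0⟩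
  have heq : p + (r : ℂ) • (p - x) - x = ((1 + r : ℝ) : ℂ) • (p - x) := by
    push_cast
    rw [add_smul, one_smul]
    abel
  rw [dist_eq_norm, dist_eq_norm, heq, norm_smul, Complex.norm_real, Real.norm_eq_abs,
    abs_of_pos (by linarith)] at hfar
  have : 0 < ‖p - x‖ := norm_pos_iff.2 hpx
  nlinarith

/-- If `D` is B-regular and `A ⊆ ∂D`, then `ω*(x, A, D) = 0` for every
`x ∈ ∂D` not lying in the interior, relative to `∂D`, of the closure of `A`. -/
theorem bndExtStar_eq_zero_of_BRegular {n : ℕ}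
    (D A : Set (EuclideanSpace ℂ (Fin n))) (hD : IsBddDomain D)
    (hreg : BRegular D) (hA : A ⊆ frontier D) :
    ∀ x ∈ frontier D,
      (¬ ∃ W : Set (EuclideanSpace ℂ (Fin n)),
        IsOpen W ∧ x ∈ W ∧ W ∩ frontier D ⊆ closure A) →
      bndExtStar x A D = 0 := by
  intro x hx hW
  push Not at hW
  apply le_antisymm
  · apply Filter.limsup_le_of_le (by isBoundedDefault)
    filter_upwards [self_mem_nhdsWithin] with z hz
    apply sSup_le
    rintro w ⟨u, -, hu, -, rfl⟩
    exact hu z hz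
  · apply le_of_forall_lt
    intro c hc
    obtain ⟨c', hcc', hc'⟩ := exists_between hc
    refine lt_of_lt_of_le hcc' ?_
    apply Filter.le_limsup_of_frequently_le _ (by isBoundedDefault)
    rw [Filter.frequently_iff]
    intro U hU
    obtain ⟨V, hVo, hxV, hVU⟩ := mem_nhdsWithin.1 hU
    obtain ⟨y, ⟨hyV, hyD⟩, hyA⟩ := Set.not_subset.1 (hW V hVo hxV)
    obtain ⟨r, hr, hrA⟩ := Metric.isOpen_iff.1 isClosed_closure.isOpen_compl y hyA
    obtain ⟨F, hFc, hFp, hFf⟩ := hreg (fun z => max (-1) (-(dist z y / r))) (by fun_prop)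
    have hF0 : ∀ z ∈ D, F z ≤ 0 := by
      apply psh_max_principle hD hFc hFp hx
      intro z hz
      rw [hFf z hz]
      apply max_le (by norm_num)
      have : 0 ≤ dist z y / r := by positivity
      linarith
    have hlim : ∀ z ∈ frontier D, Tendsto (fun z => ((F z : ℝ) : EReal)) (𝓝[D] z)
        (𝓝 ((F z : ℝ) : EReal)) := by
      intro z hz
      have h1 : Tendsto F (𝓝[D] z) (𝓝 (F z)) :=
        (hFc z (frontier_subset_closure hz)).mono subset_closure
      exact (continuous_coe_real_ereal.tendsto _).comp h1
    have hne : ∀ z ∈ frontier D, (𝓝[D] z).NeBot := fun z hz =>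
      mem_closure_iff_nhdsWithin_neBot.1 (frontier_subset_closure hz)
    have hω : ∀ z ∈ D, ((F z : ℝ) : EReal) ≤ bndExt z A D := by
      intro z hz
      apply le_sSup
      refine ⟨fun z => ((F z : ℝ) : EReal), ⟨hFp, z, hz, EReal.coe_ne_bot _⟩, ?_, ?_, rfl⟩
      · intro w hw
        exact EReal.coe_nonpos.2 (hF0 w hw)
      · intro a ha
        have := hne a (hA ha)
        have hd : r ≤ dist a y := by
          by_contra! h
          exact hrA (Metric.mem_ball.2 h) (subset_closure ha)
        have h1 : F a = -1 := by
          rw [hFf a (hA ha)]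
          apply max_eq_left
          have : 1 ≤ dist a y / r := by rwa [le_div_iff₀ hr, one_mul]
          linarith
        unfold uscReg
        rw [(hlim a (hA ha)).limsup_eq, h1]
        simp
    have := hne y hyD
    have hFy : F y = 0 := by
      rw [hFf y hyD]
      simp
    have hly := hlim y hyD
    rw [hFy] at hly
    have hev : ∀ᶠ z in 𝓝[D] y, c' < ((F z : ℝ) : EReal) :=
      hly.eventually (lt_mem_nhds (by simpa using hc'))
    have hevV : ∀ᶠ z in 𝓝[D] y, z ∈ V := mem_nhdsWithin_of_mem_nhds (hVo.mem_nhds hyV)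
    obtain ⟨z, hz1, hz2, hz3⟩ := (hev.and (hevV.and self_mem_nhdsWithin)).exists
    exact ⟨z, hVU ⟨hz2, hz3⟩, hz1.le.trans (hω z hz3)⟩
end

section
/- Let D ⊆ ℂⁿ be a B-regular bounded domain and K ⊆ ∂D compact. Then for every z ∈ D, ω₁(z, K, D) = ω(z, K, D), where ω₁(z, K, D) = sup{u(z) : u ∈ PSH(D) ∩ C(cl(D)), u ≤ 0, u ≤ -1 on K}. -/
open Complex Metric MeasureTheory Filter Topology Set

/-- Average over the boundary of the disc `c + ζ b`. -/
noncomputable def dAvg {E : Type*} [NormedAddCommGroup E] [NormedSpace ℂ E]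
    (w : E → ℝ) (c b : E) : ℝ :=
  (2 * Real.pi)⁻¹ * ∫ θ in (0:ℝ)..(2 * Real.pi), w (c + Complex.exp (θ * Complex.I) • b)

section helpers

variable {E : Type*} [NormedAddCommGroup E] [NormedSpace ℂ E]

lemma toReal_max_coe (x y : ℝ) : (max (x : EReal) (y : EReal)).toReal = max x y := by
  rw [← EReal.coe_strictMono.monotone.map_max, EReal.toReal_coe]

lemma two_pi_inv_pos : (0:ℝ) < (2 * Real.pi)⁻¹ := inv_pos.mpr Real.two_pi_pos

lemma norm_exp_smul (θ : ℝ) (b : E) : ‖Complex.exp (θ * Complex.I) • b‖ = ‖b‖ := by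
  rw [norm_smul, Complex.norm_exp_ofReal_mul_I, one_mul]

lemma cont_circ {w : E → ℝ} {S : Set E} (hw : ContinuousOn w S) {c b : E}
    (h : ∀ θ : ℝ, c + Complex.exp (θ * Complex.I) • b ∈ S) :
    Continuous (fun θ : ℝ => w (c + Complex.exp (θ * Complex.I) • b)) := by
  have : Continuous (fun θ : ℝ => c + Complex.exp (θ * Complex.I) • b) := by fun_prop
  exact hw.comp_continuous this h

lemma dAvg_const (k : ℝ) (c b : E) : dAvg (fun _ => k) c b = k := by
  unfold dAvg
  have := Real.two_pi_pos
  simp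
  field_simp

lemma dAvg_mono {w w' : E → ℝ} {c b c' : E}
    (h1 : IntervalIntegrable (fun θ : ℝ => w (c + Complex.exp (θ * Complex.I) • b)) volume 0
      (2 * Real.pi))
    (h2 : IntervalIntegrable (fun θ : ℝ => w' (c' + Complex.exp (θ * Complex.I) • b)) volume 0
      (2 * Real.pi))
    (h : ∀ θ : ℝ, w (c + Complex.exp (θ * Complex.I) • b) ≤
      w' (c' + Complex.exp (θ * Complex.I) • b)) :
    dAvg w c b ≤ dAvg w' c' b := by
  unfold dAvg
  refine mul_le_mul_of_nonneg_left ?_ two_pi_inv_pos.le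
  exact intervalIntegral.integral_mono Real.two_pi_pos.le h1 h2 h

lemma dAvg_sub {w w' : E → ℝ} {c b : E}
    (h1 : IntervalIntegrable (fun θ : ℝ => w (c + Complex.exp (θ * Complex.I) • b)) volume 0
      (2 * Real.pi))
    (h2 : IntervalIntegrable (fun θ : ℝ => w' (c + Complex.exp (θ * Complex.I) • b)) volume 0
      (2 * Real.pi)) :
    dAvg (fun y => w y - w' y) c b = dAvg w c b - dAvg w' c b := by
  unfold dAvg
  rw [intervalIntegral.integral_sub h1 h2, mul_sub]

/-- Local sub-mean value property. -/
def LocSub (w : E → ℝ) (D : Set E) : Prop :=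
  ∀ c ∈ D, ∃ ρ > 0, ∀ b : E, ‖b‖ < ρ → w c ≤ dAvg w c b

lemma max_principle [ProperSpace E] [Nontrivial E] {w : E → ℝ} {D : Set E} (hD : IsOpen D)
    (hb : Bornology.IsBounded D) (hw : ContinuousOn w (closure D)) (hl : LocSub w D)
    (hf : ∀ x ∈ frontier D, w x ≤ 0) : ∀ x ∈ closure D, w x ≤ 0 := by
  by_contra! hcon
  obtain ⟨x₀, hx₀, hpos⟩ := hcon
  have hc : IsCompact (closure D) := hb.isCompact_closure
  obtain ⟨x₁, hx₁, hmax⟩ := hc.exists_isMaxOn ⟨x₀, hx₀⟩ hw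
  have hM : 0 < w x₁ := lt_of_lt_of_le hpos (hmax hx₀)
  have hS : IsCompact (closure D ∩ w ⁻¹' {w x₁}) :=
    hc.of_isClosed_subset (hw.preimage_isClosed_of_isClosed isClosed_closure isClosed_singleton)
      inter_subset_left
  obtain ⟨p, ⟨hp, hpw⟩, hpmax⟩ := hS.exists_isMaxOn ⟨x₁, hx₁, rfl⟩ continuous_norm.continuousOn
  have hpw : w p = w x₁ := hpw
  have hpD : p ∈ D := by
    by_contra hn
    have : p ∈ frontier D := by
      rw [hD.frontier_eq]; exact ⟨hp, hn⟩
    have := hf p this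
    linarith
  obtain ⟨ρ, hρ, hsub⟩ := hl p hpD
  obtain ⟨ρ', hρ', hball⟩ := Metric.isOpen_iff.mp hD p hpD
  obtain ⟨b, hb1, hb2, hb3⟩ : ∃ b : E, ‖b‖ < ρ ∧ ‖b‖ < ρ' ∧ ‖p‖ < ‖p + b‖ := by
    set t := min ρ ρ' / 2 with ht
    have htpos : 0 < t := by positivity
    have ht1 : t < ρ := by have := min_le_left ρ ρ'; linarith
    have ht2 : t < ρ' := by have := min_le_right ρ ρ'; linarith
    by_cases hp0 : p = 0
    · obtain ⟨b, hb⟩ := NormedSpace.exists_lt_norm ℂ E 0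
      refine ⟨((t / ‖b‖ : ℝ) : ℂ) • b, ?_⟩
      have : ‖((t / ‖b‖ : ℝ) : ℂ) • b‖ = t := by
        rw [norm_smul, Complex.norm_real, Real.norm_of_nonneg (by positivity)]
        field_simp
      rw [hp0, zero_add, this, norm_zero]
      exact ⟨ht1, ht2, htpos⟩
    · have hpn : 0 < ‖p‖ := norm_pos_iff.mpr hp0
      refine ⟨((t / ‖p‖ : ℝ) : ℂ) • p, ?_⟩
      have h1 : ‖((t / ‖p‖ : ℝ) : ℂ) • p‖ = t := by
        rw [norm_smul, Complex.norm_real, Real.norm_of_nonneg (by positivity)]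
        field_simp
      have h2 : p + ((t / ‖p‖ : ℝ) : ℂ) • p = ((1 + t / ‖p‖ : ℝ) : ℂ) • p := by
        push_cast; rw [add_smul, one_smul]
      rw [h1, h2, norm_smul, Complex.norm_real, Real.norm_of_nonneg (by positivity)]
      refine ⟨ht1, ht2, ?_⟩
      have : 0 < t / ‖p‖ := by positivity
      nlinarith
  have hin : ∀ θ : ℝ, p + Complex.exp (θ * Complex.I) • b ∈ D := by
    intro θ
    apply hball
    rw [mem_ball_iff_norm, add_sub_cancel_left, norm_exp_smul]
    exact hb2
  have hcont := cont_circ (hw.mono subset_closure) hin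
  have hle : ∀ θ : ℝ, w (p + Complex.exp (θ * Complex.I) • b) ≤ w x₁ := fun θ =>
    hmax (subset_closure (hin θ))
  have hlt : w (p + Complex.exp ((0:ℝ) * Complex.I) • b) < w x₁ := by
    refine lt_of_le_of_ne (hle 0) fun heq => ?_
    have h1 : ‖p + Complex.exp ((0:ℝ) * Complex.I) • b‖ ≤ ‖p‖ :=
      hpmax ⟨subset_closure (hin 0), heq⟩
    simp at h1
    linarith
  have hintg : ∫ θ in (0:ℝ)..(2 * Real.pi), w (p + Complex.exp (θ * Complex.I) • b) <
      ∫ θ in (0:ℝ)..(2 * Real.pi), w x₁ := by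
    refine intervalIntegral.integral_lt_integral_of_continuousOn_of_le_of_exists_lt
      Real.two_pi_pos hcont.continuousOn continuousOn_const (fun θ _ => hle θ)
      ⟨0, ⟨le_rfl, Real.two_pi_pos.le⟩, hlt⟩
  have h3 := hsub b hb1
  have h4 : dAvg w p b < dAvg (fun _ => w x₁) p b := by
    unfold dAvg
    exact mul_lt_mul_of_pos_left hintg two_pi_inv_pos
  rw [dAvg_const] at h4
  linarith

/-- Trigonometric polynomials approximate continuous functions on the circle. -/
lemma exists_poly {φ : ℂ → ℝ} (hφ : ContinuousOn φ (sphere 0 1)) {ε : ℝ} (hε : 0 < ε) :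
    ∃ P : Polynomial ℂ, ∀ ζ ∈ sphere (0:ℂ) 1, |φ ζ - (P.eval ζ).re| < ε := by
  have : Fact (0 < 2 * Real.pi) := ⟨Real.two_pi_pos⟩
  let q : C(AddCircle (2 * Real.pi), ℂ) :=
    ⟨fun x => ((φ (AddCircle.toCircle x : ℂ) : ℝ) : ℂ), by
      refine Complex.continuous_ofReal.comp (hφ.comp_continuous ?_ ?_)
      · exact continuous_subtype_val.comp AddCircle.continuous_toCircle
      · intro x; rw [mem_sphere_zero_iff_norm]; exact Circle.norm_coe _⟩
  have hq : q ∈ (Submodule.span ℂ (range <| @fourier (2 * Real.pi))).topologicalClosure := by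
    rw [span_fourier_closure_eq_top]; trivial
  have hq' : q ∈ closure (Submodule.span ℂ (range <| @fourier (2 * Real.pi)) :
      Set C(AddCircle (2 * Real.pi), ℂ)) := hq
  obtain ⟨g, hg, hgd⟩ := Metric.mem_closure_iff.mp hq' ε hε
  have key : ∃ P Q : Polynomial ℂ, ∀ x, g x = P.eval (AddCircle.toCircle x : ℂ) +
      (starRingEnd ℂ) (Q.eval (AddCircle.toCircle x : ℂ)) := by
    refine Submodule.span_induction (p := fun g _ => ∃ P Q : Polynomial ℂ, ∀ x,
      g x = P.eval (AddCircle.toCircle x : ℂ) +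
      (starRingEnd ℂ) (Q.eval (AddCircle.toCircle x : ℂ))) ?_ ?_ ?_ ?_ hg
    · rintro _ ⟨k, rfl⟩
      obtain ⟨m, rfl | rfl⟩ := k.eq_nat_or_neg
      · refine ⟨Polynomial.X ^ m, 0, fun x => ?_⟩
        rw [fourier_apply]
        simp [AddCircle.toCircle_nsmul]
      · refine ⟨0, Polynomial.X ^ m, fun x => ?_⟩
        rw [fourier_neg, fourier_apply]
        simp [AddCircle.toCircle_nsmul]
    · exact ⟨0, 0, fun x => by simp⟩
    · rintro g₁ g₂ _ _ ⟨P₁, Q₁, h₁⟩ ⟨P₂, Q₂, h₂⟩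
      refine ⟨P₁ + P₂, Q₁ + Q₂, fun x => ?_⟩
      simp [h₁, h₂]; ring
    · rintro a g₁ _ ⟨P₁, Q₁, h₁⟩
      refine ⟨Polynomial.C a * P₁, Polynomial.C ((starRingEnd ℂ) a) * Q₁, fun x => ?_⟩
      simp [h₁]; ring
  obtain ⟨P, Q, hPQ⟩ := key
  refine ⟨P + Q, fun ζ hζ => ?_⟩
  obtain ⟨x, hx⟩ : ∃ x : AddCircle (2 * Real.pi), (AddCircle.toCircle x : ℂ) = ζ := by
    refine ⟨(Complex.arg ζ : ℝ), ?_⟩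
    rw [AddCircle.toCircle_apply_mk, Circle.coe_exp]
    have h1 : ‖ζ‖ = 1 := by simpa using hζ
    have := Complex.norm_mul_exp_arg_mul_I ζ
    rw [h1] at this
    have hpi := Real.pi_ne_zero
    have e : 2 * Real.pi / (2 * Real.pi) * ζ.arg = ζ.arg := by field_simp
    rw [e]
    simpa using this
  have h1 := (ContinuousMap.dist_lt_iff hε).mp hgd x
  rw [dist_eq_norm, hPQ x, hx] at h1
  have h2 : q x = ((φ ζ : ℝ) : ℂ) := by simp [q, hx]
  rw [h2] at h1
  refine lt_of_le_of_lt ?_ h1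
  refine le_trans (le_of_eq ?_) (Complex.abs_re_le_norm _)
  congr 1
  simp

lemma dAvg_poly (P : Polynomial ℂ) (c b : ℂ) :
    dAvg (fun ζ => (P.eval ζ).re) c b = (P.eval c).re := by
  have hd : Differentiable ℂ (fun ζ : ℂ => P.eval (c + ζ * b)) := by
    intro ζ
    exact (P.differentiable _).comp ζ (by fun_prop)
  have h := DiffContOnCl.circleAverage (f := fun ζ : ℂ => P.eval (c + ζ * b)) (c := 0) (R := 1)
    hd.diffContOnCl
  have hc : Continuous (fun θ : ℝ => P.eval (c + Complex.exp (θ * Complex.I) * b)) :=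
    hd.continuous.comp (f := fun θ : ℝ => Complex.exp (θ * Complex.I)) (by fun_prop)
  rw [Real.circleAverage_def] at h
  have h' := congrArg Complex.re h
  simp only [zero_mul, add_zero] at h'
  rw [← h']
  unfold dAvg
  simp only [circleMap, Complex.ofReal_one, one_mul, zero_add, smul_eq_mul]
  rw [Complex.smul_re, smul_eq_mul]
  congr 1
  exact Complex.reCLM.intervalIntegral_comp_comm (hc.intervalIntegrable _ _)

/-- One-dimensional local-to-global principle. -/
lemma loc_to_glob {φ : ℂ → ℝ} (hφ : ContinuousOn φ (closedBall 0 1))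
    (hl : LocSub φ (ball 0 1)) : φ 0 ≤ dAvg φ 0 1 := by
  refine le_of_forall_pos_le_add fun ε hε => ?_
  obtain ⟨P, hP⟩ := exists_poly (hφ.mono sphere_subset_closedBall) (half_pos hε)
  have hPc : Continuous (fun ζ : ℂ => (P.eval ζ).re) :=
    Complex.continuous_re.comp P.continuous
  have hcl : closure (ball (0:ℂ) 1) = closedBall 0 1 := closure_ball _ one_ne_zero
  have hfr : frontier (ball (0:ℂ) 1) = sphere 0 1 := frontier_ball _ one_ne_zero
  have hmp := max_principle (w := fun ζ => φ ζ - ((P.eval ζ).re + ε / 2)) (D := ball (0:ℂ) 1)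
    isOpen_ball isBounded_ball (by
      rw [hcl]; exact hφ.sub (hPc.add continuous_const).continuousOn) (by
      intro c hc
      obtain ⟨ρ, hρ, h⟩ := hl c hc
      obtain ⟨ρ', hρ', hball⟩ := Metric.isOpen_iff.mp isOpen_ball c hc
      refine ⟨min ρ ρ', lt_min hρ hρ', fun b hb => ?_⟩
      have hin : ∀ θ : ℝ, c + Complex.exp (θ * Complex.I) • b ∈ ball (0:ℂ) 1 := by
        intro θ
        apply hball
        rw [mem_ball_iff_norm, add_sub_cancel_left, norm_exp_smul]
        exact hb.trans_le (min_le_right _ _)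
      have h1 := cont_circ (hφ.mono ball_subset_closedBall) hin
      have h2 := cont_circ (hPc.continuousOn (s := univ)) (c := c) (b := b) (fun _ => trivial)
      have h3 := h b (hb.trans_le (min_le_left _ _))
      have h4 := dAvg_poly (P + Polynomial.C ((ε/2 : ℝ) : ℂ)) c b
      have h5 : (fun ζ => ((P + Polynomial.C ((ε/2 : ℝ) : ℂ)).eval ζ).re) =
          fun ζ => (P.eval ζ).re + ε / 2 := by
        funext ζ
        rw [Polynomial.eval_add, Polynomial.eval_C, Complex.add_re, Complex.ofReal_re]
      rw [h5] at h4
      rw [dAvg_sub (w' := fun ζ => (P.eval ζ).re + ε / 2) (h1.intervalIntegrable _ _)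
        ((h2.add continuous_const).intervalIntegrable _ _), h4]
      have h6 := congrFun h5 c
      rw [h6]
      linarith) (by
      rw [hfr]
      intro x hx
      have := abs_lt.mp (hP x hx)
      linarith [this.2])
  have h0 := hmp 0 (by rw [hcl]; simp)
  have hin : ∀ θ : ℝ, (0:ℂ) + Complex.exp (θ * Complex.I) • (1:ℂ) ∈ sphere (0:ℂ) 1 := by
    intro θ
    simp [Complex.norm_exp_ofReal_mul_I]
  have h1 := cont_circ (hφ.mono sphere_subset_closedBall) hin
  have h2 := cont_circ (hPc.continuousOn (s := univ)) (c := 0) (b := 1) (fun _ => trivial)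
  have h4 := dAvg_mono (w := fun ζ => (P.eval ζ).re) (w' := fun ζ => φ ζ - (-(ε/2)))
    (c := 0) (c' := 0) (b := (1:ℂ)) (h2.intervalIntegrable _ _)
    ((h1.sub continuous_const).intervalIntegrable _ _) (by
      intro θ
      have := abs_lt.mp (hP _ (hin θ))
      linarith [this.1])
  rw [dAvg_poly, dAvg_sub (w' := fun _ => -(ε/2)) (h1.intervalIntegrable _ _)
    (continuous_const.intervalIntegrable _ _), dAvg_const] at h4
  linarith

/-- Continuous functions with the local sub-mean value property are plurisubharmonic. -/
lemma pshOn_of_locSub {v : E → ℝ} {D : Set E} (hv : ContinuousOn v D)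
    (hl : LocSub v D) : PshOn (fun y => ((v y : ℝ) : EReal)) D := by
  have hcE : ContinuousOn (fun y => ((v y : ℝ) : EReal)) D :=
    continuous_coe_real_ereal.comp_continuousOn hv
  refine ⟨hcE.upperSemicontinuousOn, fun z _ => EReal.coe_ne_top _, fun a b => ⟨?_, ?_⟩⟩
  · refine ContinuousOn.upperSemicontinuousOn ?_
    exact hcE.comp (by fun_prop) (fun ζ hζ => hζ)
  · intro c r hr hsub m
    have hin : ∀ ζ : ℂ, ‖ζ‖ ≤ 1 → (a + c • b) + ζ • ((r : ℂ) • b) ∈ D := by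
      intro ζ hζ
      have h1 : c + ζ * r ∈ closedBall c r := by
        rw [mem_closedBall_iff_norm, add_sub_cancel_left, norm_mul, Complex.norm_real,
          Real.norm_of_nonneg hr.le]
        nlinarith
      have h2 : a + (c + ζ * r) • b ∈ D := hsub h1
      rwa [add_smul, ← add_assoc, mul_smul] at h2
    have key : v (a + c • b) ≤ dAvg v (a + c • b) ((r : ℂ) • b) := by
      have := loc_to_glob (φ := fun ζ : ℂ => v ((a + c • b) + ζ • ((r : ℂ) • b))) (by
          refine hv.comp (by fun_prop) ?_
          intro ζ hζ
          exact hin ζ (by simpa using hζ)) (by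
          intro ζ hζ
          obtain ⟨ρ, hρ, h⟩ := hl _ (hin ζ (by
            have : ‖ζ‖ < 1 := by simpa using hζ
            exact this.le))
          refine ⟨ρ / (‖(r : ℂ) • b‖ + 1), by positivity, fun η hη => ?_⟩
          have h1 := h (η • ((r : ℂ) • b)) (by
            rw [norm_smul]
            rw [lt_div_iff₀ (by positivity)] at hη
            nlinarith [norm_nonneg η])
          refine h1.trans (le_of_eq ?_)
          unfold dAvg
          simp only [add_smul, smul_assoc, add_assoc])
      simp only [zero_smul, add_zero] at this
      refine this.trans (le_of_eq ?_)
      unfold dAvg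
      simp
    rw [EReal.coe_le_coe_iff]
    refine key.trans ?_
    unfold dAvg truncCircleAvg
    refine mul_le_mul_of_nonneg_left ?_ two_pi_inv_pos.le
    have e : ∀ θ : ℝ, (max (((v (a + (c + (r : ℂ) * Complex.exp (θ * Complex.I)) • b) : ℝ) : EReal))
        ((-(m : ℝ) : ℝ) : EReal)).toReal =
        max (v (a + c • b + Complex.exp (θ * Complex.I) • ((r : ℂ) • b))) (-(m:ℝ)) := by
      intro θ
      rw [toReal_max_coe, add_smul, ← add_assoc, mul_comm, mul_smul]
    have h1 := cont_circ hv (c := a + c • b) (b := (r : ℂ) • b) (fun θ => hin _ (by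
      rw [Complex.norm_exp_ofReal_mul_I]))
    simp only [e]
    refine intervalIntegral.integral_mono Real.two_pi_pos.le (h1.intervalIntegrable _ _)
      ((h1.max continuous_const).intervalIntegrable _ _) (fun θ => le_max_left _ _)

lemma psh_submean {u : E → EReal} {D : Set E} (hu : PshOn u D) {c b : E}
    (hin : ∀ ζ : ℂ, ‖ζ‖ ≤ 1 → c + ζ • b ∈ D) (m : ℕ) :
    u c ≤ ((dAvg (fun y => (max (u y) ((-(m : ℝ) : ℝ) : EReal)).toReal) c b : ℝ) : EReal) := by
  have h := (hu.2.2 c b).2 0 1 one_pos (fun ζ hζ => hin ζ (by simpa using hζ)) m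
  simp only [zero_smul, add_zero] at h
  refine h.trans (le_of_eq ?_)
  unfold dAvg truncCircleAvg
  simp

lemma psh_submean_real {F : E → ℝ} {D : Set E} (hF : ContinuousOn F D)
    (hu : PshOn (fun y => ((F y : ℝ) : EReal)) D) {c b : E}
    (hin : ∀ ζ : ℂ, ‖ζ‖ ≤ 1 → c + ζ • b ∈ D) : F c ≤ dAvg F c b := by
  have hK : IsCompact ((fun ζ : ℂ => F (c + ζ • b)) '' closedBall 0 1) := by
    refine (isCompact_closedBall _ _).image_of_continuousOn ?_
    exact hF.comp (by fun_prop) (fun ζ hζ => hin ζ (by simpa using hζ))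
  obtain ⟨B, hB⟩ := hK.bddBelow
  obtain ⟨m, hm⟩ := exists_nat_ge (-B)
  have h := psh_submean hu hin m
  rw [EReal.coe_le_coe_iff] at h
  refine h.trans (le_of_eq ?_)
  unfold dAvg
  congr 1
  refine intervalIntegral.integral_congr fun θ _ => ?_
  simp only
  rw [toReal_max_coe]
  refine max_eq_left ?_
  have := hB ⟨Complex.exp (θ * Complex.I), by simp [Complex.norm_exp_ofReal_mul_I], rfl⟩
  simp only at this
  linarith

lemma disc_in {D : Set E} {c b : E} {ρ : ℝ} (h : ball c ρ ⊆ D) (hb : ‖b‖ < ρ) :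
    ∀ ζ : ℂ, ‖ζ‖ ≤ 1 → c + ζ • b ∈ D := by
  intro ζ hζ
  apply h
  rw [mem_ball_iff_norm, add_sub_cancel_left, norm_smul]
  nlinarith [norm_nonneg b]

lemma psh_locSub {F : E → ℝ} {D : Set E} (hD : IsOpen D) (hF : ContinuousOn F D)
    (hu : PshOn (fun y => ((F y : ℝ) : EReal)) D) : LocSub F D := by
  intro c hc
  obtain ⟨ρ, hρ, hball⟩ := Metric.isOpen_iff.mp hD c hc
  exact ⟨ρ, hρ, fun b hb => psh_submean_real hF hu (disc_in hball hb)⟩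


/-- Truncation of `u` at level `-1`, as a real function. -/
noncomputable def trunc1 (u : E → EReal) (y : E) : ℝ :=
  (max (u y) ((-((1 : ℕ) : ℝ) : ℝ) : EReal)).toReal

lemma coe_trunc1 {u : E → EReal} {y : E} (h : u y ≤ 0) :
    ((trunc1 u y : ℝ) : EReal) = max (u y) ((-1 : ℝ) : EReal) := by
  unfold trunc1
  rw [EReal.coe_toReal]
  · simp
  · refine ne_of_lt (max_lt (h.trans_lt (EReal.coe_lt_top 0)) (EReal.coe_lt_top _))
  · exact ne_of_gt (lt_of_lt_of_le (EReal.bot_lt_coe _) (le_max_right _ _))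

lemma trunc1_ge {u : E → EReal} {y : E} (h : u y ≤ 0) : -1 ≤ trunc1 u y := by
  rw [← EReal.coe_le_coe_iff, coe_trunc1 h]; exact le_max_right _ _

lemma le_trunc1 {u : E → EReal} {y : E} (h : u y ≤ 0) : u y ≤ ((trunc1 u y : ℝ) : EReal) := by
  rw [coe_trunc1 h]; exact le_max_left _ _

lemma trunc1_le {u : E → EReal} {y : E} (h : u y ≤ 0) {k : ℝ} (hk : u y ≤ (k : EReal))
    (hk' : -1 ≤ k) : trunc1 u y ≤ k := by
  rw [← EReal.coe_le_coe_iff, coe_trunc1 h]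
  exact max_le hk (EReal.coe_le_coe_iff.mpr hk')

lemma trunc1_nonpos {u : E → EReal} {y : E} (h : u y ≤ 0) : trunc1 u y ≤ 0 :=
  trunc1_le h (by simpa using h) (by norm_num)

lemma trunc1_integrable {u : E → EReal} {D : Set E} (hu : PshOn u D) (h0 : ∀ y ∈ D, u y ≤ 0)
    {c b : E} (hin : ∀ θ : ℝ, c + Complex.exp (θ * Complex.I) • b ∈ D) :
    IntervalIntegrable (fun θ : ℝ => trunc1 u (c + Complex.exp (θ * Complex.I) • b)) volume 0
      (2 * Real.pi) := by
  have husc : UpperSemicontinuous (fun θ : ℝ => u (c + Complex.exp (θ * Complex.I) • b)) := by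
    intro θ y hy
    have h1 := hu.1 _ (hin θ) y hy
    have hc : Continuous (fun θ : ℝ => c + Complex.exp (θ * Complex.I) • b) := by fun_prop
    exact (tendsto_nhdsWithin_iff.mpr ⟨hc.continuousAt, Eventually.of_forall hin⟩).eventually h1
  have hm : Measurable (fun θ : ℝ => trunc1 u (c + Complex.exp (θ * Complex.I) • b)) :=
    (husc.measurable.max measurable_const).ereal_toReal
  refine (intervalIntegrable_const (c := (1:ℝ))).mono_fun hm.aestronglyMeasurable ?_
  refine Eventually.of_forall fun θ => ?_
  have h1 := trunc1_ge (h0 _ (hin θ))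
  have h2 := trunc1_nonpos (h0 _ (hin θ))
  simp only [Real.norm_eq_abs, abs_one]
  rw [abs_le]; constructor <;> linarith

lemma circ_of_disc {D : Set E} {c b : E} (hin : ∀ ζ : ℂ, ‖ζ‖ ≤ 1 → c + ζ • b ∈ D) (θ : ℝ) :
    c + Complex.exp (θ * Complex.I) • b ∈ D :=
  hin _ (by rw [Complex.norm_exp_ofReal_mul_I])

lemma trunc1_submean {u : E → EReal} {D : Set E} (hu : PshOn u D) (h0 : ∀ y ∈ D, u y ≤ 0)
    {c b : E} (hin : ∀ ζ : ℂ, ‖ζ‖ ≤ 1 → c + ζ • b ∈ D) :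
    trunc1 u c ≤ dAvg (trunc1 u) c b := by
  have hc : c ∈ D := by simpa using hin 0 (by simp)
  refine trunc1_le (h0 c hc) (psh_submean hu hin 1) ?_
  rw [← dAvg_const (-1) c b]
  exact dAvg_mono (continuous_const.intervalIntegrable _ _)
    (trunc1_integrable hu h0 (circ_of_disc hin))
    (fun θ => trunc1_ge (h0 _ (circ_of_disc hin θ)))

lemma core [ProperSpace E] [Nontrivial E] {D K : Set E} (hDo : IsOpen D)
    (hDb : Bornology.IsBounded D)
    (hreg : BRegular D) (hK : IsCompact K) (hKb : K ⊆ frontier D)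
    {u : E → EReal} (hu : PshOn u D) (h0 : ∀ y ∈ D, u y ≤ 0)
    (hux : ∀ x ∈ K, uscReg u D x ≤ -1) {z : E} (hz : z ∈ D) {ε : ℝ} (hε : 0 < ε) :
    ∃ F : E → ℝ, ContinuousOn F (closure D) ∧
    PshOn (fun y => ((F y : ℝ) : EReal)) D ∧ (∀ y ∈ closure D, F y ≤ 0) ∧
    (∀ x ∈ K, F x ≤ -1) ∧ u z ≤ ((F z + 2 * ε : ℝ) : EReal) := by
  have hge : ∀ y ∈ D, -1 ≤ trunc1 u y := fun y hy => trunc1_ge (h0 y hy)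
  have hle : ∀ y ∈ D, trunc1 u y ≤ 0 := fun y hy => trunc1_nonpos (h0 y hy)
  -- neighbourhood of `K`
  have hWx : ∀ x ∈ K, ∃ W, IsOpen W ∧ x ∈ W ∧ ∀ y ∈ W ∩ D, trunc1 u y ≤ -1 + ε := by
    intro x hx
    have h1 : Filter.limsup u (nhdsWithin x D) < ((-1 + ε : ℝ) : EReal) := by
      refine lt_of_le_of_lt (hux x hx) ?_
      have : ((-1 : ℝ) : EReal) < ((-1 + ε : ℝ) : EReal) := by
        rw [EReal.coe_lt_coe_iff]; linarith
      simpa using this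
    have h2 := Filter.eventually_lt_of_limsup_lt h1
    rw [eventually_nhdsWithin_iff, _root_.eventually_nhds_iff] at h2
    obtain ⟨W, hW, hWo, hxW⟩ := h2
    exact ⟨W, hWo, hxW, fun y hy => trunc1_le (h0 y hy.2) (hW y hy.1 hy.2).le (by linarith)⟩
  choose! Wf hWo hWm hWs using hWx
  set W := ⋃ x ∈ K, Wf x with hWdef
  have hWopen : IsOpen W := isOpen_biUnion hWo
  have hKW : K ⊆ W := fun x hx => mem_biUnion hx (hWm x hx)
  have hWg : ∀ y ∈ W ∩ D, trunc1 u y ≤ -1 + ε := by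
    rintro y ⟨hy, hyD⟩
    obtain ⟨x, hx, hyx⟩ := mem_iUnion₂.mp hy
    exact hWs x hx y ⟨hyx, hyD⟩
  obtain ⟨f₀, hf₀K, hf₀W, hf₀r⟩ := exists_continuous_zero_one_of_isClosed hK.isClosed
    hWopen.isClosed_compl (by
      rw [Set.disjoint_left]; intro x hx hx'; exact hx' (hKW hx))
  obtain ⟨F, hFc, hFp, hFb⟩ := hreg (fun x => f₀ x - 1)
    (f₀.continuous.sub continuous_const).continuousOn
  have hFD : ContinuousOn F D := hFc.mono subset_closure
  have hFl : LocSub F D := psh_locSub hDo hFD hFp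
  have hF0 : ∀ x ∈ closure D, F x ≤ 0 := by
    refine max_principle hDo hDb hFc hFl fun x hx => ?_
    rw [hFb x hx]
    have := (hf₀r x).2
    linarith
  have hFK : ∀ x ∈ K, F x = -1 := by
    intro x hx
    rw [hFb x (hKb hx), hf₀K hx]; simp
  have hFm : ∀ x ∈ frontier D, -1 ≤ F x := by
    intro x hx
    rw [hFb x hx]
    have := (hf₀r x).1
    linarith
  -- local comparison near the frontier
  have hloc : ∀ x : frontier D, ∃ V, IsOpen V ∧ (x : E) ∈ V ∧
      ∀ y ∈ V ∩ D, ∀ t ∈ V ∩ closure D, trunc1 u y ≤ F t + 2 * ε := by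
    rintro ⟨x, hx⟩
    have hxc : x ∈ closure D := frontier_subset_closure hx
    have h1 : ∀ᶠ t in nhdsWithin x (closure D), F x - ε < F t :=
      (hFc x hxc).eventually (lt_mem_nhds (by linarith))
    rw [eventually_nhdsWithin_iff, _root_.eventually_nhds_iff] at h1
    obtain ⟨V, hV, hVo, hxV⟩ := h1
    by_cases hxW : x ∈ W
    · refine ⟨V ∩ W, hVo.inter hWopen, ⟨hxV, hxW⟩, fun y hy t ht => ?_⟩
      have a1 := hWg y ⟨hy.1.2, hy.2⟩
      have a2 := hV t ht.1.1 ht.2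
      have a3 := hFm x hx
      linarith
    · refine ⟨V, hVo, hxV, fun y hy t ht => ?_⟩
      have a1 := hle y hy.2
      have a2 := hV t ht.1 ht.2
      have a3 : F x = 0 := by
        rw [hFb x hx, hf₀W hxW]; simp
      linarith
  choose V hVo hVm hVs using hloc
  have hfc : IsCompact (frontier D) :=
    hDb.isCompact_closure.of_isClosed_subset isClosed_frontier frontier_subset_closure
  obtain ⟨δ₀, hδ₀, hleb⟩ := lebesgue_number_lemma_of_metric hfc hVo
    (fun x hx => mem_iUnion.mpr ⟨⟨x, hx⟩, hVm ⟨x, hx⟩⟩)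
  set δ := δ₀ / 2 with hδdef
  have hδ : 0 < δ := half_pos hδ₀
  have hnear : ∀ x ∈ frontier D, ∀ t ∈ closure D, dist t x < δ → ∀ y ∈ D, dist y t < δ →
      trunc1 u y ≤ F t + 2 * ε := by
    intro x hx t ht htx y hy hyt
    obtain ⟨i, hi⟩ := hleb x hx
    have h1 : y ∈ ball x δ₀ := by
      rw [mem_ball]; have := dist_triangle y t x; linarith
    have h2 : t ∈ ball x δ₀ := by
      rw [mem_ball]; linarith
    exact hVs i y ⟨hi h1, hy⟩ t ⟨hi h2, ht⟩
  -- sup-convolution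
  set C : ℝ := 2 / δ with hC
  have hCpos : 0 < C := by positivity
  have hDne : Nonempty D := ⟨⟨z, hz⟩⟩
  set G : E → ℝ := fun t => ⨆ y : D, (trunc1 u y - C * dist (y : E) t) with hG
  have hbdd : ∀ t, BddAbove (range fun y : D => trunc1 u y - C * dist (y : E) t) := by
    intro t
    refine ⟨0, ?_⟩
    rintro _ ⟨y, rfl⟩
    have h1 := hle y y.2
    have h2 : 0 ≤ C * dist (y : E) t := by positivity
    simp only
    linarith
  have hGge : ∀ t, ∀ y ∈ D, trunc1 u y - C * dist y t ≤ G t := fun t y hy =>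
    le_ciSup (hbdd t) (⟨y, hy⟩ : D)
  have hGle : ∀ t k, (∀ y ∈ D, trunc1 u y - C * dist y t ≤ k) → G t ≤ k := fun t k h =>
    ciSup_le fun y => h y y.2
  have hGself : ∀ t ∈ D, trunc1 u t ≤ G t := fun t ht => by simpa using hGge t t ht
  have hG0 : ∀ t, G t ≤ 0 := fun t => hGle t 0 fun y hy => by
    have h1 := hle y hy
    have h2 : 0 ≤ C * dist (y : E) t := by positivity
    linarith
  have hGlip : ∀ t t', G t ≤ G t' + C * dist t t' := by
    intro t t'
    refine hGle t _ fun y hy => ?_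
    have h1 := hGge t' y hy
    have h2 := dist_triangle y t t'
    have h3 := mul_le_mul_of_nonneg_left h2 hCpos.le
    linarith
  have hGc : Continuous G := by
    have : LipschitzWith ⟨C, hCpos.le⟩ G :=
      LipschitzWith.of_le_add_mul _ fun t t' => hGlip t t'
    exact this.continuous
  have hfar : ∀ y ∈ D, ∀ t, δ / 2 ≤ dist y t → trunc1 u y - C * dist y t ≤ -1 := by
    intro y hy t h
    have h1 := hle y hy
    have h2 := mul_le_mul_of_nonneg_left h hCpos.le
    have h3 : C * (δ / 2) = 1 := by rw [hC]; field_simp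
    linarith
  have hGnear : ∀ x ∈ frontier D, ∀ t ∈ closure D, dist t x < δ → -1 ≤ F t + 2 * ε →
      G t ≤ F t + 2 * ε := by
    intro x hx t ht htx hm
    refine hGle t _ fun y hy => ?_
    rcases lt_or_ge (dist y t) (δ / 2) with h | h
    · have h1 := hnear x hx t ht htx y hy (by linarith)
      have h2 : 0 ≤ C * dist (y : E) t := by positivity
      linarith
    · exact (hfar y hy t h).trans hm
  refine ⟨fun t => max (F t) (G t - 2 * ε), ?_, ?_, ?_, ?_, ?_⟩
  · exact hFc.sup (hGc.sub continuous_const).continuousOn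
  · have hvc : ContinuousOn (fun t => max (F t) (G t - 2 * ε)) D :=
      hFD.sup (hGc.sub continuous_const).continuousOn
    refine pshOn_of_locSub hvc ?_
    intro c hc
    obtain ⟨ρ, hρ, hball⟩ := Metric.isOpen_iff.mp hDo c hc
    rcases le_or_gt (G c - 2 * ε) (F c) with hcase | hcase
    · refine ⟨ρ, hρ, fun b hb => ?_⟩
      simp only [max_eq_left hcase]
      have hin := circ_of_disc (disc_in hball hb)
      refine (psh_submean_real hFD hFp (disc_in hball hb)).trans ?_
      exact dAvg_mono ((cont_circ hFD hin).intervalIntegrable _ _)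
        ((cont_circ hvc hin).intervalIntegrable _ _) (fun θ => le_max_left _ _)
    · -- the ball of radius `δ` around `c` is in `D`
      have hnf : ∀ x ∈ frontier D, δ ≤ dist c x := by
        intro x hx
        by_contra! hlt
        have h1 := hnear x hx c (subset_closure hc) hlt c hc (by simpa using hδ)
        have h2 := hGnear x hx c (subset_closure hc) hlt ((hge c hc).trans h1)
        linarith
      have hbD : ball c δ ⊆ D := by
        by_contra hns
        obtain ⟨y, hy, hyD⟩ := not_subset.mp hns
        have hpre : IsPreconnected (ball c δ) := by
          let _ : NormedSpace ℝ E := NormedSpace.restrictScalars ℝ ℂ E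
          exact (convex_ball c δ).isPreconnected
        obtain ⟨x, -, hx1, hx2⟩ := hpre D (closure D)ᶜ hDo isClosed_closure.isOpen_compl (by
            intro x hx
            by_contra hxn
            rw [mem_union, not_or, notMem_compl_iff] at hxn
            have hxf : x ∈ frontier D := by
              rw [hDo.frontier_eq]; exact ⟨hxn.2, hxn.1⟩
            have h1 := hnf x hxf
            rw [mem_ball, dist_comm] at hx
            linarith) ⟨c, mem_ball_self hδ, hc⟩ ⟨y, hy, fun hyc => by
            have h1 := hnf y (by rw [hDo.frontier_eq]; exact ⟨hyc, hyD⟩)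
            rw [mem_ball, dist_comm] at hy
            linarith⟩
        exact hx2 (subset_closure hx1)
      refine ⟨δ / 2, by positivity, fun b hb => ?_⟩
      simp only [max_eq_right hcase.le]
      have hdc := disc_in hbD (b := b) (by linarith)
      have hin := circ_of_disc hdc
      have hGi := cont_circ (hGc.continuousOn (s := univ)) (c := c) (b := b) (fun _ => trivial)
      have step : G c ≤ dAvg G c b := by
        refine hGle c _ fun y hy => ?_
        rcases lt_or_ge (dist y c) (δ / 2) with h | h
        · have hdy : ∀ ζ : ℂ, ‖ζ‖ ≤ 1 → y + ζ • b ∈ D := by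
            refine disc_in (ρ := δ / 2) (fun t ht => hbD ?_) hb
            rw [mem_ball] at ht ⊢
            have := dist_triangle t y c
            linarith
          have h1 := trunc1_submean hu h0 hdy
          have hi := trunc1_integrable hu h0 (circ_of_disc hdy)
          have h2 := dAvg_sub (w' := fun _ => C * dist y c) hi
            (continuous_const.intervalIntegrable _ _)
          rw [dAvg_const] at h2
          have h3 := dAvg_mono (w := fun t => trunc1 u t - C * dist y c) (w' := G) (c := y)
            (c' := c) (b := b)
            (hi.sub (continuous_const.intervalIntegrable _ _)) (hGi.intervalIntegrable _ _) (by
              intro θ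
              have := hGge (c + Complex.exp (θ * Complex.I) • b) _ (circ_of_disc hdy θ)
              rwa [dist_add_right] at this)
          linarith
        · refine (hfar y hy c h).trans ?_
          rw [← dAvg_const (-1) c b]
          exact dAvg_mono (continuous_const.intervalIntegrable _ _) (hGi.intervalIntegrable _ _)
            (fun θ => (hge _ (hin θ)).trans (hGself _ (hin θ)))
      have h2 := dAvg_sub (w := G) (w' := fun _ => 2 * ε) (c := c) (b := b)
        (hGi.intervalIntegrable _ _) (continuous_const.intervalIntegrable _ _)
      rw [dAvg_const] at h2
      have h3 := dAvg_mono (w := fun t => G t - 2 * ε) (w' := fun t => max (F t) (G t - 2 * ε))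
        (c := c) (c' := c) (b := b) ((hGi.sub continuous_const).intervalIntegrable _ _)
        ((cont_circ hvc hin).intervalIntegrable _ _) (fun θ => le_max_right _ _)
      linarith
  · intro y hy
    exact max_le (hF0 y hy) (by have := hG0 y; linarith)
  · intro x hx
    refine max_le (hFK x hx).le ?_
    have hxf := hKb hx
    have := hGnear x hxf x (frontier_subset_closure hxf) (by simpa using hδ)
      (by rw [hFK x hx]; linarith)
    rw [hFK x hx] at this
    linarith
  · refine (le_trunc1 (h0 z hz)).trans ?_
    rw [EReal.coe_le_coe_iff]
    have h1 := hGself z hz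
    have h2 := le_max_right (F z) (G z - 2 * ε)
    linarith

lemma cont_le_ext {D K : Set E} (hKb : K ⊆ frontier D) {z : E} (hz : z ∈ D) :
    bndExtCont z K D ≤ bndExt z K D := by
  refine sSup_le ?_
  rintro _ ⟨F, hFc, hFp, hF0, hFK, rfl⟩
  refine le_sSup ⟨fun y => ((F y : ℝ) : EReal), ⟨hFp, z, hz, EReal.coe_ne_bot _⟩, ?_, ?_, rfl⟩
  · intro y hy
    exact EReal.coe_nonpos.mpr (hF0 y (subset_closure hy))
  · intro x hx
    have hxc : x ∈ closure D := frontier_subset_closure (hKb hx)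
    have : (nhdsWithin x D).NeBot := mem_closure_iff_nhdsWithin_neBot.mp hxc
    have ht : Tendsto (fun y => ((F y : ℝ) : EReal)) (nhdsWithin x D) (nhds ((F x : ℝ) : EReal)) :=
      (continuous_coe_real_ereal.tendsto _).comp
        ((hFc x hxc).mono_left (nhdsWithin_mono x subset_closure))
    unfold uscReg
    rw [ht.limsup_eq]
    have h1 : ((F x : ℝ) : EReal) ≤ ((-1 : ℝ) : EReal) := EReal.coe_le_coe_iff.mpr (hFK x hx)
    simpa using h1

lemma pshOn_zero (D : Set E) : PshOn (fun _ => (((0:ℝ) : ℝ) : EReal)) D := by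
  refine pshOn_of_locSub (v := fun _ => (0:ℝ)) continuousOn_const ?_
  intro c _
  exact ⟨1, one_pos, fun b _ => by rw [dAvg_const]⟩

end helpers

/-- If `D` is B-regular and `K ⊆ ∂D` is compact, then
`ω₁(z, K, D) = ω(z, K, D)` for every `z ∈ D`. -/
theorem bndExtCont_eq_bndExt_of_BRegular {n : ℕ}
    (D K : Set (EuclideanSpace ℂ (Fin n))) (hD : IsBddDomain D)
    (hreg : BRegular D) (hK : IsCompact K) (hKb : K ⊆ frontier D) :
    ∀ z ∈ D, bndExtCont z K D = bndExt z K D := by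
  intro z hz
  refine le_antisymm (cont_le_ext hKb hz) ?_
  refine sSup_le ?_
  rintro _ ⟨u, hu, h0, hux, rfl⟩
  rcases subsingleton_or_nontrivial (EuclideanSpace ℂ (Fin n)) with hs | hs
  · have hDu : D = univ := Subsingleton.eq_univ_of_nonempty ⟨z, hz⟩
    refine (h0 z hz).trans (le_sSup ⟨fun _ => 0, continuousOn_const, pshOn_zero D,
      fun _ _ => le_rfl, ?_, by simp⟩)
    intro x hx
    have := hKb hx
    rw [hDu, frontier_univ] at this
    exact this.elim
  · refine EReal.le_of_forall_lt_iff_le.mp ?_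
    intro k hk
    obtain ⟨k', hk1, hk2⟩ := EReal.lt_iff_exists_real_btwn.mp hk
    rw [EReal.coe_lt_coe_iff] at hk2
    obtain ⟨F, hFc, hFp, hF0, hFK, hFz⟩ := core hD.1 hD.2.2 hreg hK hKb hu.1 h0 hux hz
      (ε := (k - k') / 2) (by linarith)
    have h1 : ((F z : ℝ) : EReal) ≤ bndExtCont z K D :=
      le_sSup ⟨F, hFc, hFp, hF0, hFK, rfl⟩
    have h2 := EReal.coe_lt_coe_iff.mp (h1.trans_lt hk1)
    refine hFz.trans (EReal.coe_le_coe_iff.mpr ?_)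
    linarith
end
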